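/- Let n ≥ 3, let 𝔹_u be a model inward-cusp ball, let h : 𝔹 → 𝔹_u be a homeomorphism of finite conformal energy, and let H : cl(𝔹) → cl(𝔹_u) be a continuous extension of h. Set o = 0 ∈ ℝⁿ and o′ = (1, 0, …, 0) ∈ ∂𝔹 and assume H(o′) = o. Then there exists an increasing function ε : [0,1) → [0,∞) with ε(τ) → 0 as τ → 0⁺ such that for every x′ ∈ cl(𝔹) with 0 < |x′ − o′| < 1 one has |H(x′) − o| ≤ ε(|x′ − o′|) · (log(1/|x′ − o′|))^{−1/n}. -/

import Mathlib

open MeasureTheory Metric Set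
open scoped ENNReal NNReal

noncomputable section

abbrev Euc (n : ℕ) : Type := EuclideanSpace ℝ (Fin n)

/-- Operator norm of an `n × n` real matrix, viewed as a linear operator on Euclidean space. -/
noncomputable def opNorm {n : ℕ} (M : Matrix (Fin n) (Fin n) ℝ) : ℝ :=
  ‖LinearMap.toContinuousLinearMap (Matrix.toEuclideanLin M)‖

/-- `g` belongs to the Sobolev class `W^{1,p}(Ω, ℝⁿ)` with weak differential `Dg`:
`g` and `Dg` are locally integrable on `Ω`, the integration-by-parts identity holds against
every smooth compactly supported test function supported in `Ω`, and `|Dg| ∈ L^p(Ω)`. -/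
structure MemSobolev {n : ℕ} (p : ℝ) (Ω : Set (Euc n))
    (g : Euc n → Euc n) (Dg : Euc n → Matrix (Fin n) (Fin n) ℝ) : Prop where
  locInt : ∀ i : Fin n, LocallyIntegrableOn (fun x => g x i) Ω volume
  locIntD : ∀ i j : Fin n, LocallyIntegrableOn (fun x => Dg x i j) Ω volume
  parts : ∀ φ : Euc n → ℝ, ContDiff ℝ ((⊤ : ℕ∞) : WithTop ℕ∞) φ → HasCompactSupport φ →
    tsupport φ ⊆ Ω → ∀ i j : Fin n,
      ∫ x in Ω, g x i * fderiv ℝ φ x (EuclideanSpace.single j 1) =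
        - ∫ x in Ω, Dg x i j * φ x
  lp : IntegrableOn (fun x => opNorm (Dg x) ^ p) Ω volume

/-- `g` belongs to the local Sobolev class `W^{1,1}_loc(Ω, ℝⁿ)` with weak differential `Dg`. -/
structure MemSobolevLoc {n : ℕ} (Ω : Set (Euc n))
    (g : Euc n → Euc n) (Dg : Euc n → Matrix (Fin n) (Fin n) ℝ) : Prop where
  locInt : ∀ i : Fin n, LocallyIntegrableOn (fun x => g x i) Ω volume
  locIntD : ∀ i j : Fin n, LocallyIntegrableOn (fun x => Dg x i j) Ω volume
  parts : ∀ φ : Euc n → ℝ, ContDiff ℝ ((⊤ : ℕ∞) : WithTop ℕ∞) φ → HasCompactSupport φ →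
    tsupport φ ⊆ Ω → ∀ i j : Fin n,
      ∫ x in Ω, g x i * fderiv ℝ φ x (EuclideanSpace.single j 1) =
        - ∫ x in Ω, Dg x i j * φ x

/-- `h : 𝕏 → 𝕐` is a homeomorphism of `𝕏` onto `𝕐` with inverse `f`. -/
structure IsHomeoOn {n : ℕ} (h f : Euc n → Euc n) (𝕏 𝕐 : Set (Euc n)) : Prop where
  mapsTo : Set.MapsTo h 𝕏 𝕐
  mapsTo_inv : Set.MapsTo f 𝕐 𝕏
  left_inv : ∀ x ∈ 𝕏, f (h x) = x
  right_inv : ∀ y ∈ 𝕐, h (f y) = y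
  continuousOn : ContinuousOn h 𝕏
  continuousOn_inv : ContinuousOn f 𝕐

/-- The inner distortion function `K_I(·, h)` of a Sobolev map with weak differential `Dh`;
`D♯h` is the cofactor (adjugate) matrix, given by Cramer's rule `(D♯h)(Dh) = (det Dh)·Id`. -/
noncomputable def innerDistortion {n : ℕ} (Dh : Euc n → Matrix (Fin n) (Fin n) ℝ)
    (x : Euc n) : ℝ≥0∞ :=
  if 0 < (Dh x).det then
    ENNReal.ofReal (opNorm ((Dh x).adjugate) ^ n / (Dh x).det ^ (n - 1))
  else if (Dh x).adjugate = 0 then 1 else ⊤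

/-- The open unit ball `𝔹 ⊂ ℝⁿ`. -/
def unitBall (n : ℕ) : Set (Euc n) := Metric.ball 0 1

/-- The slit `I = {(t,0) : 0 ≤ t < 1}`, the first coordinate playing the role of `t`. -/
def slit (n : ℕ) [NeZero n] : Set (Euc n) :=
  {p | 0 ≤ p 0 ∧ p 0 < 1 ∧ ∀ i : Fin n, i ≠ 0 → p i = 0}

/-- The model inward-cusp ball `𝔹_u = 𝔹 \ {(t,x) : t ≥ 0, |x| ≤ u(t)}`. -/
noncomputable def cuspBall (n : ℕ) [NeZero n] (u : ℝ → ℝ) : Set (Euc n) :=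
  Metric.ball 0 1 \
    {p | 0 ≤ p 0 ∧ Real.sqrt (∑ i ∈ Finset.univ.erase (0 : Fin n), p i ^ 2) ≤ u (p 0)}

/-- `u` is a model cusp profile: a strictly increasing continuous surjection of `[0,∞)` onto
itself, `C¹` on `(0,∞)`, with `u′` increasing on `(0,∞)`, `u′(s) → 0` as `s → 0⁺`, `u(1) = 1`. -/
structure IsModelCusp (u : ℝ → ℝ) : Prop where
  continuousOn : ContinuousOn u (Set.Ici 0)
  contDiffOn : ContDiffOn ℝ 1 u (Set.Ioi 0)
  strictMonoOn : StrictMonoOn u (Set.Ici 0)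
  mapsTo : Set.MapsTo u (Set.Ici 0) (Set.Ici 0)
  surjOn : Set.SurjOn u (Set.Ici 0) (Set.Ici 0)
  deriv_mono : MonotoneOn (deriv u) (Set.Ioi 0)
  deriv_tendsto : Filter.Tendsto (deriv u) (nhdsWithin 0 (Set.Ioi 0)) (nhds 0)
  one : u 1 = 1

/-- The cusp profile `u(t) = e / exp(t^{-α})` for `t > 0`, and `u(0) = 0`. -/
noncomputable def cuspFun (α : ℝ) (t : ℝ) : ℝ :=
  if 0 < t then Real.exp 1 / Real.exp (t ^ (-α)) else 0

/-- The sphere `S_t = {y ∈ 𝔹_u : |y| = t}` inside the cusp ball. -/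
def cuspS (n : ℕ) [NeZero n] (u : ℝ → ℝ) (t : ℝ) : Set (Euc n) :=
  {y ∈ cuspBall n u | ‖y‖ = t}

/-- The boundary circle `C_t = {y ∈ ∂𝔹_u : |y| = t}`. -/
def cuspC (n : ℕ) [NeZero n] (u : ℝ → ℝ) (t : ℝ) : Set (Euc n) :=
  {y ∈ frontier (cuspBall n u) | ‖y‖ = t}

/-- `S′_t = h⁻¹(S_t) ⊆ 𝔹`. -/
def cuspS' (n : ℕ) [NeZero n] (u : ℝ → ℝ) (h : Euc n → Euc n) (t : ℝ) : Set (Euc n) :=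
  {x ∈ unitBall n | h x ∈ cuspS n u t}

/-- `C′_t = cl(S′_t) ∩ ∂𝔹`. -/
def cuspC' (n : ℕ) [NeZero n] (u : ℝ → ℝ) (h : Euc n → Euc n) (t : ℝ) : Set (Euc n) :=
  closure (cuspS' n u h t) ∩ Metric.sphere (0 : Euc n) 1

open Filter Topology

lemma aux_jensen {α : Type*} [MeasurableSpace α] (μ : Measure α) (m : ℕ) (F : α → ℝ≥0∞)
    (hF : AEMeasurable F μ) :
    (∫⁻ x, F x ∂μ) ^ (m + 1) ≤ (μ univ) ^ m * ∫⁻ x, F x ^ (m + 1) ∂μ := by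
  rcases Nat.eq_zero_or_pos m with rfl | hm
  · simp
  have hmR : (0:ℝ) < m := by exact_mod_cast hm
  have hpq : ((m:ℝ) + 1).HolderConjugate (((m:ℝ) + 1) / m) := by
    rw [Real.holderConjugate_iff]
    constructor
    · linarith
    · field_simp; ring
  have h1 := ENNReal.lintegral_mul_le_Lp_mul_Lq μ hpq hF
    (aemeasurable_const (b := (1:ℝ≥0∞)))
  have h2 : ∫⁻ x, F x ∂μ ≤ (∫⁻ x, F x ^ (m+1) ∂μ) ^ (1 / ((m:ℝ)+1)) *
      (μ univ) ^ (1 / (((m:ℝ) + 1) / m)) := by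
    have e : ∀ x, F x ^ ((m:ℝ)+1) = F x ^ (m+1) := by
      intro x
      rw [← ENNReal.rpow_natCast]; push_cast; rfl
    simpa [e] using h1
  calc (∫⁻ x, F x ∂μ) ^ (m + 1) ≤ ((∫⁻ x, F x ^ (m+1) ∂μ) ^ (1 / ((m:ℝ)+1)) *
      (μ univ) ^ (1 / (((m:ℝ) + 1) / m))) ^ (m+1) := by gcongr
    _ = _ := by
      rw [mul_pow, ← ENNReal.rpow_natCast, ← ENNReal.rpow_mul, ← ENNReal.rpow_natCast,
        ← ENNReal.rpow_mul, mul_comm, ← ENNReal.rpow_natCast (μ univ) m]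
      congr 1
      · congr 1; push_cast; field_simp
      · have : 1 / ((m:ℝ)+1) * ((m+1 : ℕ):ℝ) = 1 := by push_cast; field_simp
        rw [this, ENNReal.rpow_one]

lemma aux_scale {m : ℕ} (p : Fin m → ℝ) (s : ℝ) (hs : 0 < s) (F : (Fin m → ℝ) → ℝ≥0∞)
    (hF : Measurable F) :
    ∫⁻ z, F (p + s • (z - p)) = ENNReal.ofReal ((s ^ m)⁻¹) * ∫⁻ z, F z := by
  have h1 : ∫⁻ z, F (p + s • (z - p)) = ∫⁻ z, F (p + s • z) :=
    lintegral_sub_right_eq_self (fun z => F (p + s • z)) p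
  have h2 : ∫⁻ z, F (p + s • z) = ∫⁻ z, F (p + z) ∂(Measure.map (fun x => s • x) volume) := by
    rw [lintegral_map (by fun_prop) (by fun_prop)]
  rw [h1, h2, Measure.map_addHaar_smul _ hs.ne', lintegral_smul_measure,
    lintegral_add_left_eq_self (fun z => F z) p]
  simp [abs_of_pos (inv_pos.2 (pow_pos hs m))]

lemma aux_sint (m : ℕ) :
    ∫⁻ s in Ioo (0:ℝ) 1, ENNReal.ofReal ((s ^ m)⁻¹) ^ (1 / ((m:ℝ)+1)) = (m + 1 : ℝ≥0∞) := by
  have hm : (0:ℝ) < (m:ℝ) + 1 := by positivity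
  have hlt : -1 < -((m:ℝ) / (m+1)) := by
    rw [neg_lt_neg_iff, div_lt_one hm]; linarith
  have e : ∫⁻ s in Ioo (0:ℝ) 1, ENNReal.ofReal ((s ^ m)⁻¹) ^ (1 / ((m:ℝ)+1))
      = ∫⁻ s in Ioo (0:ℝ) 1, ENNReal.ofReal (s ^ (-((m:ℝ)/(m+1)))) := by
    apply setLIntegral_congr_fun measurableSet_Ioo
    intro s hs
    dsimp only
    rw [ENNReal.ofReal_rpow_of_nonneg (by have := hs.1; positivity) (by positivity)]
    congr 1
    rw [← Real.rpow_natCast, ← Real.rpow_neg hs.1.le, ← Real.rpow_mul hs.1.le]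
    congr 1
    field_simp
  rw [e, ← ofReal_integral_eq_lintegral_ofReal]
  · rw [← integral_Ioc_eq_integral_Ioo, ← intervalIntegral.integral_of_le zero_le_one,
      integral_rpow (Or.inl hlt)]
    have h3 : -((m:ℝ)/(m+1)) + 1 = 1 / (m+1) := by field_simp; ring
    rw [h3, Real.one_rpow, Real.zero_rpow (by positivity), sub_zero, one_div_one_div]
    have : (m:ℝ) + 1 = ((m+1 : ℕ) : ℝ) := by push_cast; rfl
    rw [this, ENNReal.ofReal_natCast]; push_cast; rfl
  · have := intervalIntegral.intervalIntegrable_rpow' (a := 0) (b := 1) hlt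
    rw [intervalIntegrable_iff_integrableOn_Ioo_of_le zero_le_one] at this
    exact this
  · refine (ae_restrict_iff' measurableSet_Ioo).2 (Eventually.of_forall fun s hs => ?_)
    exact Real.rpow_nonneg hs.1.le _

lemma aux_morrey_half {m : ℕ} (D : Set (Fin m → ℝ)) (hD : Convex ℝ D) (hDm : MeasurableSet D)
    (M : (Fin m → ℝ) → ℝ≥0∞) (hM : Measurable M) (p : Fin m → ℝ) (hp : p ∈ D) :
    ∫⁻ z in D, ∫⁻ s in Ioo (0:ℝ) 1, M (p + s • (z - p)) ≤
      (m + 1) * (volume D ^ m * ∫⁻ z in D, M z ^ (m+1)) ^ (1 / ((m:ℝ)+1)) := by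
  have hm : (0:ℝ) < (m:ℝ) + 1 := by positivity
  rw [lintegral_lintegral_swap (by
    apply Measurable.aemeasurable
    unfold Function.uncurry
    fun_prop)]
  have key : ∀ s ∈ Ioo (0:ℝ) 1, ∫⁻ z in D, M (p + s • (z - p)) ≤
      ENNReal.ofReal ((s ^ m)⁻¹) ^ (1 / ((m:ℝ)+1)) *
        (volume D ^ m * ∫⁻ z in D, M z ^ (m+1)) ^ (1 / ((m:ℝ)+1)) := by
    intro s hs
    have h1 := aux_jensen (volume.restrict D) m (fun z => M (p + s • (z - p))) (by fun_prop)
    have h2 : ∫⁻ z in D, M (p + s • (z - p)) ^ (m+1) ≤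
        ENNReal.ofReal ((s ^ m)⁻¹) * ∫⁻ z in D, M z ^ (m+1) := by
      rw [← lintegral_indicator hDm, ← lintegral_indicator hDm,
        ← aux_scale p s hs.1 _ ((hM.pow_const _).indicator hDm)]
      apply lintegral_mono
      intro z
      dsimp only
      by_cases hz : z ∈ D
      · have : p + s • (z - p) ∈ D := hD.add_smul_sub_mem hp hz ⟨hs.1.le, hs.2.le⟩
        simp [hz, this]
      · simp [hz]
    rw [← ENNReal.mul_rpow_of_nonneg _ _ (by positivity), one_div, ENNReal.le_rpow_inv_iff hm]
    have e : ∀ x : ℝ≥0∞, x ^ ((m:ℝ)+1) = x ^ (m+1) := by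
      intro x
      rw [← ENNReal.rpow_natCast]; push_cast; rfl
    rw [e]
    refine h1.trans ?_
    rw [Measure.restrict_apply_univ]
    calc _ ≤ volume D ^ m * (ENNReal.ofReal ((s ^ m)⁻¹) * ∫⁻ z in D, M z ^ (m+1)) := by gcongr
      _ = _ := by ring
  calc _ ≤ ∫⁻ s in Ioo (0:ℝ) 1, ENNReal.ofReal ((s ^ m)⁻¹) ^ (1 / ((m:ℝ)+1)) *
        (volume D ^ m * ∫⁻ z in D, M z ^ (m+1)) ^ (1 / ((m:ℝ)+1)) :=
        setLIntegral_mono' measurableSet_Ioo key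
    _ = _ := by
      rw [lintegral_mul_const _ (by fun_prop), aux_sint]

lemma aux_morrey {m : ℕ} (D : Set (Fin m → ℝ)) (hD : Convex ℝ D) (hDm : MeasurableSet D)
    (hD0 : volume D ≠ 0) (hDt : volume D ≠ ⊤)
    (M : (Fin m → ℝ) → ℝ≥0∞) (hM : Measurable M) (d : ℝ≥0∞) (G : (Fin m → ℝ) → ℝ)
    (hG : ∀ p ∈ D, ∀ z ∈ D,
      ENNReal.ofReal |G p - G z| ≤ d * ∫⁻ s in Ioo (0:ℝ) 1, M (p + s • (z - p)))
    (p q : Fin m → ℝ) (hp : p ∈ D) (hq : q ∈ D) :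
    ENNReal.ofReal |G p - G q| ^ (m+1) * volume D ≤
      (2 * d * (m+1)) ^ (m+1) * ∫⁻ z in D, M z ^ (m+1) := by
  have hm : (0:ℝ) < (m:ℝ) + 1 := by positivity
  set X := ENNReal.ofReal |G p - G q|
  set R := (volume D ^ m * ∫⁻ z in D, M z ^ (m+1)) ^ (1 / ((m:ℝ)+1)) with hR
  have meas : ∀ p : Fin m → ℝ, Measurable fun z => ∫⁻ s in Ioo (0:ℝ) 1, M (p + s • (z - p)) := by
    intro p
    apply Measurable.lintegral_prod_right
    unfold Function.uncurry
    fun_prop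
  have h1 : X * volume D ≤ 2 * d * (m+1) * R := by
    calc X * volume D = ∫⁻ z in D, X := by simp
      _ ≤ ∫⁻ z in D, (d * (∫⁻ s in Ioo (0:ℝ) 1, M (p + s • (z - p))) +
            d * ∫⁻ s in Ioo (0:ℝ) 1, M (q + s • (z - q))) := by
          apply setLIntegral_mono' hDm
          intro z hz
          refine le_trans ?_ (add_le_add (hG p hp z hz) (hG q hq z hz))
          rw [← ENNReal.ofReal_add (abs_nonneg _) (abs_nonneg _)]
          apply ENNReal.ofReal_le_ofReal
          rw [abs_sub_comm (G q)]
          exact abs_sub_le _ _ _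
      _ ≤ d * ((m+1) * R) + d * ((m+1) * R) := by
          rw [lintegral_add_left (by exact (meas p).const_mul d),
            lintegral_const_mul _ (meas p), lintegral_const_mul _ (meas q)]
          gcongr
          · exact aux_morrey_half D hD hDm M hM p hp
          · exact aux_morrey_half D hD hDm M hM q hq
      _ = _ := by ring
  have h2 : R ^ (m+1) = volume D ^ m * ∫⁻ z in D, M z ^ (m+1) := by
    rw [hR, ← ENNReal.rpow_natCast, ← ENNReal.rpow_mul]
    have : 1 / ((m:ℝ)+1) * ((m+1 : ℕ):ℝ) = 1 := by push_cast; field_simp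
    rw [this, ENNReal.rpow_one]
  have h3 : (X * volume D) ^ (m+1) ≤ (2 * d * (m+1) * R) ^ (m+1) := by gcongr
  rw [mul_pow, mul_pow _ R, h2] at h3
  have h4 : volume D ^ m * (X ^ (m+1) * volume D) ≤
      volume D ^ m * ((2 * d * (m+1)) ^ (m+1) * ∫⁻ z in D, M z ^ (m+1)) := by
    calc _ = X ^ (m + 1) * volume D ^ (m + 1) := by ring
      _ ≤ _ := h3
      _ = _ := by ring
  exact (ENNReal.mul_le_mul_iff_right (pow_ne_zero _ hD0) (ENNReal.pow_ne_top hDt)).1 h4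

lemma aux_normsq {n : ℕ} [NeZero n] (y : Euc n) :
    ‖y‖ ^ 2 = y 0 ^ 2 + ∑ i ∈ Finset.univ.erase (0 : Fin n), y i ^ 2 := by
  rw [EuclideanSpace.real_norm_sq_eq, Finset.add_sum_erase _ (fun i => y i ^ 2) (Finset.mem_univ _)]

lemma aux_u0 {u : ℝ → ℝ} (hu : IsModelCusp u) : u 0 = 0 := by
  obtain ⟨a, ha, hau⟩ := hu.surjOn (show (0:ℝ) ∈ Ici 0 by simp)
  have h1 : u 0 ≤ u a := hu.strictMonoOn.monotoneOn (by simp) ha ha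
  have h2 : u 0 ∈ Ici (0:ℝ) := hu.mapsTo (by simp)
  exact le_antisymm (h1.trans hau.le) h2

lemma aux_sphere_conn {n : ℕ} [NeZero n] {u : ℝ → ℝ} (hu : IsModelCusp u) {t : ℝ} (ht : 0 < t)
    (ht1 : t < 1) : IsPreconnected (cuspS n u t) := by
  apply isPreconnected_of_forall (EuclideanSpace.single (0 : Fin n) (-t))
  intro y hy
  obtain ⟨⟨hyb, hyc⟩, hyn⟩ := hy
  set S := ∑ i ∈ Finset.univ.erase (0 : Fin n), y i ^ 2 with hS
  have hS0 : 0 ≤ S := Finset.sum_nonneg fun i _ => sq_nonneg _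
  have hsq := aux_normsq y
  rw [hyn, ← hS] at hsq
  have hy0 : -t ≤ y 0 ∧ y 0 ≤ t := abs_le_of_sq_le_sq' (by nlinarith) ht.le
  let γ : ℝ → Euc n := fun c => WithLp.toLp 2 fun i =>
    if i = 0 then c else (Real.sqrt (t ^ 2 - c ^ 2) / Real.sqrt S) * y i
  have hγc : Continuous γ := by
    apply (PiLp.continuous_toLp 2 _).comp
    apply continuous_pi
    intro i
    by_cases hi : i = 0
    · simp only [hi, if_true]; exact continuous_id
    · simp only [hi, if_false]; fun_prop
  have hγ0 : ∀ c, γ c 0 = c := fun c => by simp [γ]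
  have hSzero : S = 0 → y 0 = -t ∧ ∀ i, i ≠ 0 → y i = 0 := by
    intro h0
    constructor
    · have : y 0 ^ 2 = t ^ 2 := by linarith
      rcases sq_eq_sq_iff_eq_or_eq_neg.1 this with h | h
      · exfalso
        apply hyc
        refine ⟨by rw [h]; exact ht.le, ?_⟩
        show Real.sqrt S ≤ _
        rw [h0, Real.sqrt_zero, h]
        exact hu.mapsTo ht.le
      · exact h
    · intro i hi
      have := (Finset.sum_eq_zero_iff_of_nonneg (fun i _ => sq_nonneg (y i))).1 h0 i
        (by simp [hi])
      simpa using this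
  have hsum : ∀ c ∈ Icc (-t) (y 0),
      ∑ i ∈ Finset.univ.erase (0 : Fin n), (γ c) i ^ 2 = t ^ 2 - c ^ 2 := by
    intro c hc
    have hct : c ^ 2 ≤ t ^ 2 := by nlinarith [hc.1, hc.2, hy0.2]
    have e : ∑ i ∈ Finset.univ.erase (0 : Fin n), (γ c) i ^ 2
        = (Real.sqrt (t ^ 2 - c ^ 2) / Real.sqrt S) ^ 2 * S := by
      rw [hS, Finset.mul_sum]
      apply Finset.sum_congr rfl
      intro i hi
      have hi0 : i ≠ 0 := (Finset.mem_erase.1 hi).1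
      simp [γ, hi0, mul_pow, hS]
    rw [e, div_pow, Real.sq_sqrt (by linarith), Real.sq_sqrt hS0]
    by_cases h0 : S = 0
    · have := (hSzero h0).1
      have hcc : c = -t := le_antisymm (this ▸ hc.2) hc.1
      rw [h0, hcc]; simp
    · field_simp
  refine ⟨γ '' Icc (-t) (y 0), ?_, ?_, ?_, isPreconnected_Icc.image _ hγc.continuousOn⟩
  · rintro _ ⟨c, hc, rfl⟩
    have hn : ‖γ c‖ = t := by
      have := aux_normsq (γ c)
      rw [hsum c hc, hγ0] at this
      have h2 : ‖γ c‖ ^ 2 = t ^ 2 := by linarith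
      exact (pow_left_inj₀ (norm_nonneg _) ht.le two_ne_zero).1 h2
    refine ⟨⟨?_, ?_⟩, hn⟩
    · simp [hn, ht1]
    · rintro ⟨h1, h2⟩
      rw [hγ0] at h1
      rw [hsum c hc, hγ0] at h2
      apply hyc
      refine ⟨h1.trans hc.2, ?_⟩
      have h3 : u c ≤ u (y 0) := hu.strictMonoOn.monotoneOn h1 (h1.trans hc.2) hc.2
      refine le_trans ?_ (h2.trans h3)
      apply Real.sqrt_le_sqrt
      show S ≤ _
      nlinarith [hc.2]
  · refine ⟨-t, ⟨le_refl _, hy0.1⟩, ?_⟩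
    ext i
    by_cases hi : i = 0
    · subst hi; simp [γ]
    · simp [γ, hi]
  · refine ⟨y 0, ⟨hy0.1, le_refl _⟩, ?_⟩
    ext i
    by_cases hi : i = 0
    · subst hi; simp [γ]
    · have : t ^ 2 - y 0 ^ 2 = S := by linarith
      simp only [γ, hi, if_false, this]
      by_cases h0 : S = 0
      · simp [(hSzero h0).2 i hi]
      · have : Real.sqrt S ≠ 0 := by rw [Real.sqrt_ne_zero hS0]; exact h0
        field_simp

lemma aux_ray {n : ℕ} [NeZero n] {u : ℝ → ℝ} (hu : IsModelCusp u) (k : Fin n) (hk : k ≠ 0)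
    (s : ℝ) (hs : s ≠ 0) (hs1 : |s| < 1) : EuclideanSpace.single k s ∈ cuspBall n u := by
  refine ⟨by simpa using hs1, ?_⟩
  rintro ⟨-, h2⟩
  have h0 : (EuclideanSpace.single k s : Euc n) 0 = 0 := by simp [hk.symm]
  rw [h0, aux_u0 hu] at h2
  have h3 := aux_normsq (EuclideanSpace.single k s : Euc n)
  rw [h0] at h3
  have h4 := Real.sqrt_eq_zero'.1 (le_antisymm h2 (Real.sqrt_nonneg _))
  have h5 : ‖(EuclideanSpace.single k s : Euc n)‖ ^ 2 ≤ 0 := by rw [h3]; simpa using h4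
  simp at h5
  exact hs h5

lemma aux_topo {n : ℕ} [NeZero n] (hn : 3 ≤ n) {u : ℝ → ℝ} (hu : IsModelCusp u)
    (h f : Euc n → Euc n) (hhf : IsHomeoOn h f (unitBall n) (cuspBall n u))
    (H : Euc n → Euc n) (hHc : ContinuousOn H (closure (unitBall n)))
    (hHeq : Set.EqOn H h (unitBall n)) (o' : Euc n) (ho' : o' ∈ closure (unitBall n))
    (hHo : H o' = 0) (N : Euc n → ℝ) (hN : Continuous N) (hNc : ∀ r, Convex ℝ {x | N x < r})
    (hNo : N o' = 0) (r : ℝ) (hr : 0 < r)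
    (hhalf : ∀ x ∈ unitBall n, N x ≤ r → ‖h x‖ ≤ 1 / 2) (δ : ℝ) (hδ : 0 < δ)
    (hS : ∀ p ∈ unitBall n, ∀ q ∈ unitBall n, N p = r → N q = r → ‖h p - h q‖ ≤ δ) :
    ∀ x ∈ unitBall n, N x < r → ‖h x‖ ≤ 2 * δ := by
  intro x hx hxr
  by_contra! hT
  have hT2 := hhalf x hx hxr.le
  -- existence of a good level
  obtain ⟨t, ht1, ht2, htS⟩ : ∃ t, δ / 2 < t ∧ t < 2 * δ ∧
      ∀ p ∈ unitBall n, N p = r → ‖h p‖ ≠ t := by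
    by_cases hc : ∀ p ∈ unitBall n, N p = r → ‖h p‖ ≠ 6 / 10 * δ
    · exact ⟨6 / 10 * δ, by linarith, by linarith, hc⟩
    · push Not at hc
      obtain ⟨p, hp, hpr, hpn⟩ := hc
      refine ⟨19 / 10 * δ, by linarith, by linarith, fun q hq hqr hqn => ?_⟩
      have h1 := hS q hq p hp hqr hpr
      have h2 := norm_sub_norm_le (h q) (h p)
      linarith
  have ht0 : 0 < t := by linarith
  -- a point of small image
  obtain ⟨x1, hx1, hx1r, hx1t⟩ : ∃ x1 ∈ unitBall n, N x1 < r ∧ ‖h x1‖ < t := by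
    have h1 : ∀ᶠ z in 𝓝[closure (unitBall n)] o', ‖H z‖ < t ∧ N z < r := by
      have c1 : Tendsto (fun z => ‖H z‖) (𝓝[closure (unitBall n)] o') (𝓝 0) := by
        have := (hHc o' ho').norm
        unfold ContinuousWithinAt at this
        simpa [hHo] using this
      have c2 : Tendsto N (𝓝[closure (unitBall n)] o') (𝓝 0) := by
        have := hN.continuousWithinAt (s := closure (unitBall n)) (x := o')
        unfold ContinuousWithinAt at this
        rwa [hNo] at this
      exact (c1.eventually_lt_const ht0).and (c2.eventually_lt_const hr)
    have h2 : ∀ᶠ z in 𝓝[unitBall n] o', ‖H z‖ < t ∧ N z < r :=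
      h1.filter_mono (nhdsWithin_mono _ subset_closure)
    have : (𝓝[unitBall n] o').NeBot := mem_closure_iff_nhdsWithin_neBot.1 ho'
    obtain ⟨z, hz, hzb⟩ := (h2.and self_mem_nhdsWithin).exists
    exact ⟨z, hzb, hz.2, by rw [← hHeq hzb]; exact hz.1⟩
  -- a point of level t
  have hconv : IsPreconnected (unitBall n ∩ {x | N x < r}) :=
    ((convex_ball (0 : Euc n) 1).inter (hNc r)).isPreconnected
  have hcont : ContinuousOn (fun z => ‖h z‖) (unitBall n ∩ {x | N x < r}) :=
    (hhf.continuousOn.mono inter_subset_left).norm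
  obtain ⟨x2, ⟨hx2, hx2r⟩, hx2t⟩ := hconv.intermediate_value (a := x1) (b := x) ⟨hx1, hx1r⟩
    ⟨hx, hxr⟩ hcont ⟨hx1t.le, (ht2.trans hT).le⟩
  have hfN : ContinuousOn (fun y => N (f y)) (cuspBall n u) :=
    hN.comp_continuousOn hhf.continuousOn_inv
  have hin : ∀ y ∈ cuspS n u t, N (f y) < r := by
    intro y hy
    by_contra! hyr
    have hy2 : h x2 ∈ cuspS n u t := ⟨hhf.mapsTo hx2, hx2t⟩
    obtain ⟨z, hz, hzr⟩ := (aux_sphere_conn hu ht0 (by linarith)).intermediate_value hy2 hy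
      (hfN.mono fun y hy => hy.1)
      ⟨by rw [hhf.left_inv _ hx2]; exact (show N x2 < r from hx2r).le, hyr⟩
    refine htS (f z) (hhf.mapsTo_inv hz.1) hzr ?_
    rw [hhf.right_inv _ hz.1]; exact hz.2
  -- rays
  obtain ⟨k, hk⟩ : ∃ k : Fin n, k ≠ 0 := by
    refine ⟨⟨1, by omega⟩, ?_⟩
    intro hh
    have := congrArg Fin.val hh
    simp at this
  have ray : ∀ σ : ℝ, |σ| = 1 → ∃ s, t ≤ s ∧ s < 1 ∧
      N (f (EuclideanSpace.single k (σ * s))) = r := by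
    intro σ hσ
    have hmem : ∀ s ∈ Icc t (3/4), EuclideanSpace.single k (σ * s) ∈ cuspBall n u := by
      intro s hs
      have hs0 : 0 < s := ht0.trans_le hs.1
      have ha : |σ * s| = s := by rw [abs_mul, hσ, one_mul, abs_of_pos hs0]
      apply aux_ray hu k hk
      · intro h0; rw [h0, abs_zero] at ha; linarith
      · rw [ha]; linarith [hs.2]
    have hc : ContinuousOn (fun s : ℝ => N (f (EuclideanSpace.single k (σ * s)))) (Icc t (3/4)) := by
      apply hfN.comp _ hmem
      have : (fun s : ℝ => (EuclideanSpace.single k (σ * s) : Euc n)) =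
          fun s => (σ * s) • EuclideanSpace.single k (1:ℝ) := by
        funext s; ext i; by_cases hi : i = k <;> simp [hi]
      rw [this]
      fun_prop
    have htt : t ≤ 3 / 4 := by linarith
    have hlo : N (f (EuclideanSpace.single k (σ * t))) < r := by
      apply hin
      refine ⟨hmem t ⟨le_refl _, htt⟩, ?_⟩
      simp [hσ, abs_mul, abs_of_pos ht0]
    have hhi : r < N (f (EuclideanSpace.single k (σ * (3/4)))) := by
      by_contra! hle
      have hm := hmem (3/4) ⟨htt, le_refl _⟩
      have := hhalf _ (hhf.mapsTo_inv hm) hle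
      rw [hhf.right_inv _ hm] at this
      have e : ‖(EuclideanSpace.single k (σ * (3/4)) : Euc n)‖ = 3 / 4 := by
        simp [hσ, abs_mul]
      rw [e] at this
      norm_num at this
    obtain ⟨s, hs, hsr⟩ := intermediate_value_Icc htt hc ⟨hlo.le, hhi.le⟩
    exact ⟨s, hs.1, by linarith [hs.2], hsr⟩
  obtain ⟨s, hs, hs1, hsr⟩ := ray 1 (by simp)
  obtain ⟨s', hs', hs1', hsr'⟩ := ray (-1) (by simp)
  have m1 : EuclideanSpace.single k (1 * s) ∈ cuspBall n u := by
    apply aux_ray hu k hk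
    · linarith
    · rw [one_mul, abs_of_pos] <;> linarith
  have m2 : EuclideanSpace.single k (-1 * s') ∈ cuspBall n u := by
    apply aux_ray hu k hk
    · linarith
    · rw [abs_mul, abs_of_pos (a := s') (by linarith)]; simpa using hs1'
  have hfin := hS _ (hhf.mapsTo_inv m1) _ (hhf.mapsTo_inv m2) hsr hsr'
  rw [hhf.right_inv _ m1, hhf.right_inv _ m2] at hfin
  have e : (EuclideanSpace.single k (1 * s) - EuclideanSpace.single k (-1 * s') : Euc n) =
      EuclideanSpace.single k (s + s') := by
    ext i; by_cases hi : i = k <;> simp [hi]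
  rw [e, PiLp.norm_single, Real.norm_eq_abs, abs_of_pos (by linarith)] at hfin
  linarith

lemma aux_entry {n : ℕ} (A : Matrix (Fin n) (Fin n) ℝ) (i j : Fin n) : |A i j| ≤ opNorm A := by
  have h1 := (LinearMap.toContinuousLinearMap (Matrix.toEuclideanLin A)).le_opNorm
    (EuclideanSpace.single j (1:ℝ))
  have h2 : (Matrix.toEuclideanLin A (EuclideanSpace.single j (1:ℝ))) i = A i j := by
    simp [Matrix.toEuclideanLin]
  have h3 := PiLp.norm_apply_le (Matrix.toEuclideanLin A (EuclideanSpace.single j (1:ℝ))) i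
  rw [h2, Real.norm_eq_abs] at h3
  refine h3.trans ?_
  simpa [opNorm] using h1

lemma aux_W {n : ℕ} (hn : n ≠ 0) (h : Euc n → Euc n) (Dh : Euc n → Matrix (Fin n) (Fin n) ℝ)
    (hSob : MemSobolev (n : ℝ) (unitBall n) h Dh) :
    ∃ W : Euc n → ℝ≥0∞, Measurable W ∧ ∫⁻ x, W x ^ n ≠ ⊤ ∧
      ∀ i j, ∀ᵐ x ∂(volume.restrict (unitBall n)), ‖Dh x i j‖ₑ ≤ W x := by
  have hB : MeasurableSet (unitBall n) := measurableSet_ball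
  let W0 : Euc n → ℝ≥0∞ := fun x => ∑ i, ∑ j, ‖Dh x i j‖ₑ
  have hW0 : AEMeasurable W0 (volume.restrict (unitBall n)) := by
    apply Finset.aemeasurable_fun_sum
    intro i _
    apply Finset.aemeasurable_fun_sum
    intro j _
    exact (hSob.locIntD i j).aestronglyMeasurable.enorm
  refine ⟨(unitBall n).indicator (hW0.mk W0), hW0.measurable_mk.indicator hB, ?_, ?_⟩
  · have e1 : ∀ x, (unitBall n).indicator (hW0.mk W0) x ^ n =
        (unitBall n).indicator (fun x => hW0.mk W0 x ^ n) x := by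
      intro x
      by_cases hx : x ∈ unitBall n <;> simp [hx, hn]
    simp_rw [e1]
    rw [lintegral_indicator hB]
    have e2 : ∫⁻ x in unitBall n, hW0.mk W0 x ^ n = ∫⁻ x in unitBall n, W0 x ^ n := by
      apply lintegral_congr_ae
      filter_upwards [hW0.ae_eq_mk] with x hx
      rw [hx]
    rw [e2]
    have h2 : ∫⁻ x in unitBall n, W0 x ^ n ≤ ∫⁻ x in unitBall n,
        ((n : ℝ≥0∞) * n) ^ n * ‖opNorm (Dh x) ^ (n:ℝ)‖ₑ := by
      apply lintegral_mono
      intro x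
      have h0 : 0 ≤ opNorm (Dh x) := norm_nonneg _
      have h1 : W0 x ≤ (n : ℝ≥0∞) * n * ENNReal.ofReal (opNorm (Dh x)) := by
        calc W0 x ≤ ∑ i : Fin n, ∑ j : Fin n, ENNReal.ofReal (opNorm (Dh x)) := by
              apply Finset.sum_le_sum; intro i _; apply Finset.sum_le_sum; intro j _
              rw [← ofReal_norm]
              exact ENNReal.ofReal_le_ofReal (aux_entry _ i j)
          _ = _ := by simp [mul_assoc]
      calc W0 x ^ n ≤ ((n : ℝ≥0∞) * n * ENNReal.ofReal (opNorm (Dh x))) ^ n := by gcongr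
        _ = ((n : ℝ≥0∞) * n) ^ n * ‖opNorm (Dh x) ^ (n:ℝ)‖ₑ := by
          rw [mul_pow, ← ofReal_norm, Real.norm_of_nonneg (by positivity),
            Real.rpow_natCast, ENNReal.ofReal_pow h0]
    refine ne_top_of_le_ne_top ?_ h2
    rw [lintegral_const_mul' _ _ (by finiteness)]
    apply ENNReal.mul_ne_top (by finiteness)
    exact hSob.lp.2.ne
  · intro i j
    filter_upwards [hW0.ae_eq_mk, ae_restrict_mem hB] with x hx hxB
    rw [indicator_of_mem hxB, ← hx]
    refine le_trans ?_ (Finset.single_le_sum (f := fun i => ∑ j, ‖Dh x i j‖ₑ)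
      (fun _ _ => zero_le) (Finset.mem_univ i))
    exact Finset.single_le_sum (f := fun j => ‖Dh x i j‖ₑ)
      (fun _ _ => zero_le) (Finset.mem_univ j)

lemma aux_energy {n : ℕ} (hn : n ≠ 0) (ρ : Euc n → ℝ) (hρ : Continuous ρ)
    (hρ1 : ∫⁻ x, ENNReal.ofReal (ρ x) = 1) (η : ℝ) (hsupp : ∀ x, ρ x ≠ 0 → ‖x‖ < η)
    (W : Euc n → ℝ≥0∞) (hW : Measurable W) (A A' : Set (Euc n)) (hA : MeasurableSet A)
    (hA' : MeasurableSet A') (hAA : ∀ x ∈ A, ∀ z, ‖z‖ < η → x - z ∈ A') :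
    ∫⁻ x in A, (∫⁻ y, ENNReal.ofReal (ρ (x - y)) * W y) ^ n ≤ ∫⁻ x in A', W x ^ n := by
  have hm : Measurable fun x => ENNReal.ofReal (ρ x) := hρ.measurable.ennreal_ofReal
  have h1 : ∀ x ∈ A, (∫⁻ y, ENNReal.ofReal (ρ (x - y)) * W y) ^ n ≤
      ∫⁻ y, ENNReal.ofReal (ρ (x - y)) * A'.indicator (fun y => W y ^ n) y := by
    intro x hx
    obtain ⟨m, rfl⟩ := Nat.exists_eq_succ_of_ne_zero hn
    have hmx : Measurable fun y => ENNReal.ofReal (ρ (x - y)) := by fun_prop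
    have hj := aux_jensen (volume.withDensity fun y => ENNReal.ofReal (ρ (x - y))) m W
      hW.aemeasurable
    rw [lintegral_withDensity_eq_lintegral_mul _ hmx hW,
      lintegral_withDensity_eq_lintegral_mul _ hmx (hW.pow_const _),
      withDensity_apply _ MeasurableSet.univ, Measure.restrict_univ,
      lintegral_sub_left_eq_self (fun y => ENNReal.ofReal (ρ y)) x, hρ1, one_pow, one_mul] at hj
    refine hj.trans ?_
    apply lintegral_mono
    intro y
    simp only [Pi.mul_apply]
    by_cases hy : ρ (x - y) = 0
    · simp [hy]
    · have := hAA x hx (x - y) (hsupp _ hy)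
      rw [sub_sub_cancel] at this
      simp [this]
  have hmI : Measurable (A'.indicator (fun y => W y ^ n)) := (hW.pow_const _).indicator hA'
  calc _ ≤ ∫⁻ x in A, ∫⁻ y, ENNReal.ofReal (ρ (x - y)) * A'.indicator (fun y => W y ^ n) y :=
        setLIntegral_mono' hA h1
    _ ≤ ∫⁻ x, ∫⁻ y, ENNReal.ofReal (ρ (x - y)) * A'.indicator (fun y => W y ^ n) y :=
        setLIntegral_le_lintegral _ _
    _ = ∫⁻ y, ∫⁻ x, ENNReal.ofReal (ρ (x - y)) * A'.indicator (fun y => W y ^ n) y := by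
        apply lintegral_lintegral_swap
        apply Measurable.aemeasurable
        unfold Function.uncurry
        exact (by fun_prop : Measurable fun a : Euc n × Euc n => ENNReal.ofReal (ρ (a.1 - a.2))).mul
          (hmI.comp measurable_snd)
    _ = ∫⁻ y, A'.indicator (fun y => W y ^ n) y := by
        congr 1; funext y
        rw [lintegral_mul_const _ (by fun_prop),
          lintegral_sub_right_eq_self (fun x => ENNReal.ofReal (ρ x)) y, hρ1, one_mul]
    _ = _ := lintegral_indicator hA' _

lemma aux_deriv {n : ℕ} (h : Euc n → Euc n) (Dh : Euc n → Matrix (Fin n) (Fin n) ℝ)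
    (hSob : MemSobolev (n : ℝ) (unitBall n) h Dh)
    (W : Euc n → ℝ≥0∞)
    (hWD : ∀ i j, ∀ᵐ x ∂(volume.restrict (unitBall n)), ‖Dh x i j‖ₑ ≤ W x)
    (ρ : Euc n → ℝ) (hρ : ContDiff ℝ ((⊤ : ℕ∞) : WithTop ℕ∞) ρ) (hρc : HasCompactSupport ρ)
    (hρ0 : ∀ x, 0 ≤ ρ x) (η : ℝ) (hsupp : ∀ x ∈ tsupport ρ, ‖x‖ ≤ η)
    (i : Fin n) (hint : LocallyIntegrable ((unitBall n).indicator fun y => h y i))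
    (x : Euc n) (hx : ‖x‖ < 1 - η) (l : Fin n) :
    ENNReal.ofReal |fderiv ℝ (convolution ρ ((unitBall n).indicator fun y => h y i)
      (ContinuousLinearMap.lsmul ℝ ℝ) volume) x (EuclideanSpace.single l 1)| ≤
      ∫⁻ y, ENNReal.ofReal (ρ (x - y)) * W y := by
  have hB : MeasurableSet (unitBall n) := measurableSet_ball
  set gi := (unitBall n).indicator fun y => h y i with hgi
  have hρ1 : ContDiff ℝ 1 ρ := hρ.of_le (by exact_mod_cast le_top)
  have hd := hρc.hasFDerivAt_convolution_left (ContinuousLinearMap.lsmul ℝ ℝ) hρ1 hint x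
  rw [hd.fderiv]
  have hex := (hρc.fderiv ℝ).convolutionExists_left
    (ContinuousLinearMap.precompL (Euc n) (ContinuousLinearMap.lsmul ℝ ℝ))
    (hρ1.continuous_fderiv one_ne_zero) hint x
  have e1 : (convolution (fderiv ℝ ρ) gi
      (ContinuousLinearMap.precompL (Euc n) (ContinuousLinearMap.lsmul ℝ ℝ)) volume x)
      (EuclideanSpace.single l 1) =
      ∫ t, fderiv ℝ ρ t (EuclideanSpace.single l 1) * gi (x - t) := by
    unfold convolution
    rw [ContinuousLinearMap.integral_apply hex]
    rfl
  have e2 : ∫ t, fderiv ℝ ρ t (EuclideanSpace.single l 1) * gi (x - t) =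
      ∫ y, fderiv ℝ ρ (x - y) (EuclideanSpace.single l 1) * gi y := by
    rw [← integral_sub_left_eq_self _ volume x]
    simp
  let φ : Euc n → ℝ := fun y => ρ (x - y)
  have hφ : ContDiff ℝ ((⊤ : ℕ∞) : WithTop ℕ∞) φ := by
    apply hρ.comp; fun_prop
  have hφc : HasCompactSupport φ := hρc.comp_homeomorph (Homeomorph.subLeft x)
  have hφs : tsupport φ ⊆ unitBall n := by
    intro y hy
    have h1 : x - y ∈ tsupport ρ := by
      have := tsupport_comp_subset_preimage ρ (f := fun y => x - y) (by fun_prop) hy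
      exact this
    have h2 := hsupp _ h1
    have h3 : ‖y‖ ≤ ‖x‖ + ‖x - y‖ := by
      have := norm_sub_le x (x - y)
      simpa using this
    simp only [unitBall, mem_ball_zero_iff]
    linarith
  have hφd : ∀ y, fderiv ℝ φ y (EuclideanSpace.single l 1) =
      - fderiv ℝ ρ (x - y) (EuclideanSpace.single l 1) := by
    intro y
    have h1 : HasFDerivAt (fun y : Euc n => x - y) (-ContinuousLinearMap.id ℝ (Euc n)) y := by
      simpa using (hasFDerivAt_id y).const_sub x
    have h2 := ((hρ1.differentiable one_ne_zero (x - y)).hasFDerivAt).comp y h1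
    have h3 : fderiv ℝ φ y = _ := h2.fderiv
    rw [h3]; simp
  have hp := hSob.parts φ hφ hφc hφs i l
  have e3 : ∫ y, fderiv ℝ ρ (x - y) (EuclideanSpace.single l 1) * gi y =
      ∫ y in unitBall n, Dh y i l * φ y := by
    have : ∫ y, fderiv ℝ ρ (x - y) (EuclideanSpace.single l 1) * gi y =
        - ∫ y in unitBall n, h y i * fderiv ℝ φ y (EuclideanSpace.single l 1) := by
      rw [← integral_neg, ← integral_indicator hB]
      congr 1; funext y
      by_cases hy : y ∈ unitBall n
      · simp [hgi, hy, hφd]; ring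
      · simp [hgi, hy]
    rw [this, hp, neg_neg]
  rw [e1, e2, e3, ← Real.norm_eq_abs, ofReal_norm]
  calc _ ≤ ∫⁻ y in unitBall n, ‖Dh y i l * φ y‖ₑ := enorm_integral_le_lintegral_enorm _
    _ ≤ ∫⁻ y in unitBall n, ENNReal.ofReal (ρ (x - y)) * W y := by
      apply lintegral_mono_ae
      filter_upwards [hWD i l] with y hy
      rw [enorm_mul, mul_comm, ← ofReal_norm (φ y), Real.norm_of_nonneg (hρ0 _)]
      gcongr
    _ ≤ _ := setLIntegral_le_lintegral _ _

lemma aux_moll {n : ℕ} (hn : n ≠ 0) (h : Euc n → Euc n)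
    (Dh : Euc n → Matrix (Fin n) (Fin n) ℝ) (hc : ContinuousOn h (unitBall n))
    (hb : ∀ x ∈ unitBall n, ‖h x‖ ≤ 1) (hSob : MemSobolev (n : ℝ) (unitBall n) h Dh) :
    ∃ (W : Euc n → ℝ≥0∞) (M : ℕ → Euc n → ℝ≥0∞) (g : ℕ → Fin n → Euc n → ℝ) (η : ℕ → ℝ),
      Measurable W ∧ ∫⁻ x, W x ^ n ≠ ⊤ ∧ (∀ k, 0 < η k) ∧ Tendsto η atTop (𝓝 0) ∧
      (∀ k, Measurable (M k)) ∧ (∀ k i, ContDiff ℝ 1 (g k i)) ∧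
      (∀ k i x, ‖x‖ < 1 - η k → ∀ l,
        ENNReal.ofReal |fderiv ℝ (g k i) x (EuclideanSpace.single l 1)| ≤ M k x) ∧
      (∀ i, ∀ x ∈ unitBall n, Tendsto (fun k => g k i x) atTop (𝓝 (h x i))) ∧
      (∀ k A A', MeasurableSet A → MeasurableSet A' →
        (∀ x ∈ A, ∀ z, ‖z‖ < η k → x - z ∈ A') →
        ∫⁻ x in A, M k x ^ n ≤ ∫⁻ x in A', W x ^ n) := by
  have hB : MeasurableSet (unitBall n) := measurableSet_ball
  obtain ⟨W, hWm, hWf, hWD⟩ := aux_W hn h Dh hSob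
  let η : ℕ → ℝ := fun k => 1 / ((k:ℝ) + 1)
  have hη : ∀ k, 0 < η k := fun k => by positivity
  let b : ℕ → ContDiffBump (0 : Euc n) := fun k =>
    ⟨η k / 2, η k, by have := hη k; positivity, by have := hη k; linarith⟩
  let ρ : ℕ → Euc n → ℝ := fun k => (b k).normed volume
  have hηt : Tendsto η atTop (𝓝 0) := tendsto_one_div_add_atTop_nhds_zero_nat
  have hcont : ∀ k, Continuous (ρ k) := fun k => (b k).continuous_normed
  have haes : ∀ i : Fin n, AEStronglyMeasurable ((unitBall n).indicator fun y => h y i) := by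
    intro i
    rw [aestronglyMeasurable_indicator_iff hB]
    have : ContinuousOn (fun y => h y i) (unitBall n) := by
      exact (EuclideanSpace.proj (𝕜 := ℝ) i).continuous.comp_continuousOn hc
    exact this.aestronglyMeasurable hB
  have hint : ∀ i : Fin n, LocallyIntegrable ((unitBall n).indicator fun y => h y i) := by
    intro i
    apply Integrable.locallyIntegrable
    rw [integrable_indicator_iff hB]
    apply IntegrableOn.of_bound (C := 1) measure_ball_lt_top
      ((aestronglyMeasurable_indicator_iff hB).1 (haes i))
    filter_upwards [ae_restrict_mem hB] with x hx
    exact (PiLp.norm_apply_le (h x) i).trans (hb x hx)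
  refine ⟨W, fun k x => ∫⁻ y, ENNReal.ofReal (ρ k (x - y)) * W y,
    fun k i => convolution (ρ k) ((unitBall n).indicator fun y => h y i)
      (ContinuousLinearMap.lsmul ℝ ℝ) volume, η, hWm, hWf, hη, hηt, ?_, ?_, ?_, ?_, ?_⟩
  · intro k
    apply Measurable.lintegral_prod_right
    unfold Function.uncurry
    have := hcont k
    fun_prop
  · intro k i
    exact (b k).hasCompactSupport_normed.contDiff_convolution_left _
      ((b k).contDiff_normed (n := 1)) (hint i)
  · intro k i x hx l
    refine aux_deriv h Dh hSob W hWD (ρ k) (b k).contDiff_normed (b k).hasCompactSupport_normed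
      (b k).nonneg_normed (η k) ?_ i (hint i) x hx l
    intro z hz
    rw [(b k).tsupport_normed_eq] at hz
    simpa using hz
  · intro i x hx
    apply ContDiffBump.convolution_tendsto_right (x₀ := x) hηt
      (Eventually.of_forall fun _ => haes i) ?_ tendsto_const_nhds
    have h1 : Tendsto ((unitBall n).indicator fun y => h y i) (𝓝 x) (𝓝 (h x i)) := by
      have hnb : unitBall n ∈ 𝓝 x := isOpen_ball.mem_nhds hx
      have : ContinuousAt (fun y => h y i) x :=
        ((EuclideanSpace.proj (𝕜 := ℝ) i).continuous.comp_continuousOn hc).continuousAt hnb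
      refine this.tendsto.congr' ?_
      filter_upwards [hnb] with y hy
      simp [hy]
    exact h1.comp tendsto_snd
  · intro k A A' hA hA' hAA
    refine aux_energy hn (ρ k) (hcont k) ?_ (η k) ?_ W hWm A A' hA hA' hAA
    · rw [← ofReal_integral_eq_lintegral_ofReal (b k).integrable_normed
        (Eventually.of_forall (b k).nonneg_normed), (b k).integral_normed, ENNReal.ofReal_one]
    · intro x hx
      have : x ∈ Function.support ((b k).normed volume) := hx
      rw [(b k).support_normed_eq] at this
      simpa using this

def supN {n : ℕ} (o x : Euc n) : ℝ := ‖WithLp.ofLp (x - o)‖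

lemma supN_cont {n : ℕ} (o : Euc n) : Continuous (supN o) := by
  unfold supN
  exact ((PiLp.continuous_ofLp 2 _).comp (continuous_id.sub continuous_const)).norm

lemma supN_le_norm {n : ℕ} (o x : Euc n) : supN o x ≤ ‖x - o‖ := by
  unfold supN
  rw [pi_norm_le_iff_of_nonneg (norm_nonneg _)]
  intro i
  exact PiLp.norm_apply_le (x - o) i

lemma supN_le_iff {n : ℕ} (o x : Euc n) {r : ℝ} (hr : 0 ≤ r) :
    supN o x ≤ r ↔ ∀ i, |x i - o i| ≤ r := by
  unfold supN
  rw [pi_norm_le_iff_of_nonneg hr]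
  rfl

lemma supN_convex_lt {n : ℕ} (o : Euc n) (r : ℝ) : Convex ℝ {x | supN o x < r} := by
  have h := (convex_ball (WithLp.ofLp o) r).linear_preimage
    (WithLp.linearEquiv 2 ℝ (Fin n → ℝ)).toLinearMap
  have e : {x | supN o x < r} = (WithLp.linearEquiv 2 ℝ (Fin n → ℝ)).toLinearMap ⁻¹'
      ball (WithLp.ofLp o) r := by
    refine Set.ext fun x => ?_
    rw [mem_preimage, mem_ball, dist_eq_norm]
    rfl
  rw [e]
  exact h

lemma supN_convex_le {n : ℕ} (o : Euc n) (r : ℝ) : Convex ℝ {x | supN o x ≤ r} := by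
  have h := (convex_closedBall (WithLp.ofLp o) r).linear_preimage
    (WithLp.linearEquiv 2 ℝ (Fin n → ℝ)).toLinearMap
  have e : {x | supN o x ≤ r} = (WithLp.linearEquiv 2 ℝ (Fin n → ℝ)).toLinearMap ⁻¹'
      closedBall (WithLp.ofLp o) r := by
    refine Set.ext fun x => ?_
    rw [mem_preimage, mem_closedBall, dist_eq_norm]
    rfl
  rw [e]
  exact h

lemma aux_ftc {n : ℕ} (g : Euc n → ℝ) (hg : ContDiff ℝ 1 g) (p z : Euc n) (C : ℝ)
    (_hC0 : 0 ≤ C) (hC : ∀ l, |z l - p l| ≤ C) (M : Euc n → ℝ≥0∞)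
    (hM : ∀ s ∈ Ioo (0:ℝ) 1, ∀ l,
      ENNReal.ofReal |fderiv ℝ g (p + s • (z - p)) (EuclideanSpace.single l 1)| ≤
        M (p + s • (z - p))) :
    ENNReal.ofReal |g p - g z| ≤
      (ENNReal.ofReal C * n) * ∫⁻ s in Ioo (0:ℝ) 1, M (p + s • (z - p)) := by
  have hder : ∀ s : ℝ, HasDerivAt (fun s : ℝ => g (p + s • (z - p)))
      (fderiv ℝ g (p + s • (z - p)) (z - p)) s := by
    intro s
    have h1 : HasDerivAt (fun s : ℝ => p + s • (z - p)) (z - p) s := by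
      simpa using ((hasDerivAt_id s).smul_const (z - p)).const_add p
    exact ((hg.differentiable one_ne_zero _).hasFDerivAt).comp_hasDerivAt s h1
  have hcd : Continuous fun s : ℝ => fderiv ℝ g (p + s • (z - p)) (z - p) := by
    have := hg.continuous_fderiv one_ne_zero
    exact (this.comp (by fun_prop)).clm_apply continuous_const
  have hint := intervalIntegral.integral_eq_sub_of_hasDerivAt (a := 0) (b := 1)
    (fun s _ => hder s) (hcd.intervalIntegrable 0 1)
  have e1 : g z - g p = ∫ s in Ioo (0:ℝ) 1, fderiv ℝ g (p + s • (z - p)) (z - p) := by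
    rw [← integral_Ioc_eq_integral_Ioo, ← intervalIntegral.integral_of_le zero_le_one, hint]
    simp
  rw [abs_sub_comm, e1, ← Real.norm_eq_abs, ofReal_norm]
  refine (enorm_integral_le_lintegral_enorm _).trans ?_
  rw [← lintegral_const_mul' _ _ (by finiteness)]
  apply setLIntegral_mono' measurableSet_Ioo
  intro s hs
  set L := fderiv ℝ g (p + s • (z - p))
  have e2 : L (z - p) = ∑ l, (z l - p l) * L (EuclideanSpace.single l 1) := by
    have : z - p = ∑ l, (z l - p l) • (EuclideanSpace.single l (1:ℝ) : Euc n) := by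
      ext i
      simp [Finset.sum_apply, Pi.single_apply]
    conv_lhs => rw [this]
    rw [map_sum]
    simp
  rw [e2]
  calc ‖∑ l, (z l - p l) * L (EuclideanSpace.single l 1)‖ₑ
      ≤ ∑ l, ‖(z l - p l) * L (EuclideanSpace.single l 1)‖ₑ := enorm_sum_le _ _
    _ ≤ ∑ l : Fin n, ENNReal.ofReal C * M (p + s • (z - p)) := by
        apply Finset.sum_le_sum
        intro l _
        rw [enorm_mul, ← ofReal_norm, ← ofReal_norm]
        gcongr
        · exact hC l
        · exact hM s hs l
    _ = _ := by simp; ring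

lemma aux_fubini {m : ℕ} (j : Fin (m+1)) (c σ : ℝ) (hσ : σ = 1 ∨ σ = -1)
    (F : (Fin (m+1) → ℝ) → ℝ≥0∞) (hF : Measurable F) :
    ∫⁻ r : ℝ, ∫⁻ w : Fin m → ℝ, F (j.insertNth (c + σ * r) w) = ∫⁻ x, F x := by
  let e := MeasurableEquiv.piFinSuccAbove (fun _ : Fin (m+1) => ℝ) j
  have he : MeasurePreserving e.symm volume volume :=
    (volume_preserving_piFinSuccAbove (fun _ : Fin (m+1) => ℝ) j).symm
  have h1 : ∫⁻ x, F x = ∫⁻ a : ℝ, ∫⁻ w : Fin m → ℝ, F (j.insertNth a w) := by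
    rw [← he.lintegral_comp hF]
    exact lintegral_prod _ (hF.comp e.symm.measurable).aemeasurable
  rw [h1]
  rcases hσ with rfl | rfl
  · simp_rw [one_mul]
    exact lintegral_add_left_eq_self (fun a => ∫⁻ w : Fin m → ℝ, F (j.insertNth a w)) c
  · have := lintegral_sub_left_eq_self (μ := (volume : Measure ℝ))
      (fun a => ∫⁻ w : Fin m → ℝ, F (j.insertNth a w)) c
    rw [← this]
    congr 1; funext r
    have : c + -1 * r = c - r := by ring
    rw [this]

lemma aux_insert_meas {m : ℕ} (j : Fin (m+1)) :
    Measurable fun q : ℝ × (Fin m → ℝ) => (j.insertNth q.1 q.2 : Fin (m+1) → ℝ) :=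
  (MeasurableEquiv.piFinSuccAbove (fun _ : Fin (m+1) => ℝ) j).symm.measurable

lemma aux_box {m : ℕ} (r : ℝ) (hr : 0 < r) (hrn : r ≤ 1 / (2 * ((m:ℝ)+1)))
    (x : Euc (m+1)) (h0 : 1 - r ≤ x 0) (h0' : x 0 ≤ 1 - r / 2) (hi : ∀ i, i ≠ 0 → |x i| ≤ r) :
    ‖x‖ ≤ 1 - r / 4 ∧ supN (EuclideanSpace.single 0 1) x ≤ r := by
  have hm : (0:ℝ) < (m:ℝ) + 1 := by positivity
  have hr1 : r * (2 * ((m:ℝ)+1)) ≤ 1 := by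
    rwa [le_div_iff₀ (by positivity)] at hrn
  have hrle : r ≤ 1 / 2 := by nlinarith [(Nat.cast_nonneg m : (0:ℝ) ≤ m)]
  constructor
  · have hs := aux_normsq x
    have h2 : ∑ i ∈ Finset.univ.erase (0 : Fin (m+1)), x i ^ 2 ≤ m * r ^ 2 := by
      calc _ ≤ ∑ i ∈ Finset.univ.erase (0 : Fin (m+1)), r ^ 2 := by
            apply Finset.sum_le_sum
            intro i hi'
            have := hi i (Finset.mem_erase.1 hi').1
            rw [← sq_abs]; gcongr
        _ = _ := by simp
    apply abs_le_of_sq_le_sq' _ (by linarith) |>.2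
    rw [hs]
    nlinarith
  · rw [supN_le_iff _ _ hr.le]
    intro i
    by_cases h : i = 0
    · subst h
      rw [abs_le]; simp; constructor <;> linarith
    · simpa [h] using hi i h

lemma aux_face {m : ℕ} (g : Euc (m+1) → ℝ) (hg : ContDiff ℝ 1 g) (M : Euc (m+1) → ℝ≥0∞)
    (hM : Measurable M) (η r : ℝ) (hr : 0 < r) (hrn : r ≤ 1 / (2 * ((m:ℝ)+1)))
    (hηr : η < r / 4)
    (hgM : ∀ x, ‖x‖ < 1 - η → ∀ l,
      ENNReal.ofReal |fderiv ℝ g x (EuclideanSpace.single l 1)| ≤ M x)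
    (j : Fin (m+1)) (σ : ℝ) (hσ : σ = 1 ∨ σ = -1) (hjσ : j = 0 → σ = -1)
    (o : Euc (m+1)) (ho : o = EuclideanSpace.single 0 1)
    (p q : Euc (m+1)) (hp : ‖p‖ < 1 - η) (hq : ‖q‖ < 1 - η) (hpN : supN o p ≤ r)
    (hqN : supN o q ≤ r) (hpj : p j = o j + σ * r) (hqj : q j = o j + σ * r) :
    ENNReal.ofReal |g p - g q| ^ (m+1) ≤ ENNReal.ofReal ((4 * ((m:ℝ)+1)^2)^(m+1) * 2 ^ m * r) *
      ∫⁻ w : Fin m → ℝ, ({x : Fin (m+1) → ℝ | ‖WithLp.toLp 2 x‖ < 1 - η ∧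
        supN o (WithLp.toLp 2 x) ≤ r}.indicator (fun x => M (WithLp.toLp 2 x) ^ (m+1)))
          (j.insertNth (o j + σ * r) w) := by
  set a := o j + σ * r with ha
  let P : (Fin m → ℝ) → Euc (m+1) := fun w => WithLp.toLp 2 (j.insertNth a w)
  have hPj : ∀ w, P w j = a := fun w => by simp [P]
  have hPs : ∀ w i, P w (j.succAbove i) = w i := fun w i => by simp [P]
  have hPaff : ∀ x y : Fin m → ℝ, ∀ s t : ℝ, s + t = 1 → P (s • x + t • y) = s • P x + t • P y := by
    intro x y s t hst
    ext i
    rcases Fin.eq_self_or_eq_succAbove j i with rfl | ⟨i, rfl⟩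
    · simp only [PiLp.add_apply, PiLp.smul_apply, hPj, smul_eq_mul]
      rw [← add_mul, hst, one_mul]
    · simp only [PiLp.add_apply, PiLp.smul_apply, hPs, smul_eq_mul, Pi.add_apply, Pi.smul_apply]
  have hPm : Measurable P := by
    have h1 : Measurable fun w : Fin m → ℝ => (j.insertNth a w : Fin (m+1) → ℝ) :=
      (aux_insert_meas j).comp (measurable_const.prodMk measurable_id)
    exact (PiLp.continuous_toLp 2 _).measurable.comp h1
  let Cs : Set (Euc (m+1)) := ball 0 (1 - η) ∩ {x | supN o x ≤ r}
  have hCs : Convex ℝ Cs := (convex_ball _ _).inter (supN_convex_le o r)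
  have hCm : MeasurableSet Cs :=
    measurableSet_ball.inter ((supN_cont o).measurable measurableSet_Iic)
  let D : Set (Fin m → ℝ) := P ⁻¹' Cs
  have hDc : Convex ℝ D := by
    intro x hx y hy s t hs ht hst
    show P (s • x + t • y) ∈ Cs
    rw [hPaff x y s t hst]
    exact hCs hx hy hs ht hst
  have hDm : MeasurableSet D := hPm hCm
  let wc : Fin m → ℝ := fun i => if j.succAbove i = 0 then 1 - 3 * r / 4 else 0
  have hball : closedBall wc (r/4) ⊆ D := by
    intro w hw
    rw [mem_closedBall, dist_eq_norm, pi_norm_le_iff_of_nonneg (by positivity)] at hw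
    have hbox := aux_box r hr hrn (P w)
    have hw' : ∀ i, |w i - wc i| ≤ r / 4 := hw
    have hh : (1 - r ≤ P w 0 ∧ P w 0 ≤ 1 - r / 2) ∧ ∀ i, i ≠ 0 → |P w i| ≤ r := by
      constructor
      · rcases Fin.eq_self_or_eq_succAbove j 0 with h0 | ⟨i, h0⟩
        · have e : P w 0 = 1 - r := by
            rw [h0, hPj, ha, hjσ h0.symm, ho, ← h0]; simp; ring
          rw [e]; constructor <;> linarith
        · have e : P w 0 = w i := by rw [h0, hPs]
          have := hw' i
          simp only [wc, ← h0, if_true] at this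
          rw [abs_le] at this
          rw [e]; constructor <;> linarith [this.1, this.2]
      · intro i hi
        rcases Fin.eq_self_or_eq_succAbove j i with h0 | ⟨i', h0⟩
        · subst h0
          have hoi : o i = 0 := by rw [ho]; simp [hi]
          rw [hPj, ha, hoi, zero_add, abs_mul, abs_of_pos hr]
          rcases hσ with h | h <;> simp [h]
        · have := hw' i'
          have h1 : wc i' = 0 := by simp only [wc, ← h0, hi, if_false]
          rw [h1, sub_zero] at this
          rw [h0, hPs]; linarith
    have := hbox hh.1.1 hh.1.2 hh.2
    refine ⟨?_, ?_⟩
    · rw [mem_ball_zero_iff]; linarith [this.1]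
    · show supN o _ ≤ r
      rw [ho]; exact this.2
  have hvol : ENNReal.ofReal ((r/2)^m) ≤ volume D := by
    calc _ = volume (closedBall wc (r/4)) := by
          rw [Real.volume_pi_closedBall _ (by positivity), Fintype.card_fin]
          congr 2; ring
      _ ≤ _ := measure_mono hball
  have hD0 : volume D ≠ 0 := by
    have : 0 < ENNReal.ofReal ((r/2)^m) := by rw [ENNReal.ofReal_pos]; positivity
    exact (this.trans_le hvol).ne'
  have hdiff : ∀ x ∈ Cs, ∀ z ∈ Cs, ∀ l, |z l - x l| ≤ 2 * r := by
    intro x hx z hz l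
    have h1 := (supN_le_iff o x hr.le).1 hx.2 l
    have h2 := (supN_le_iff o z hr.le).1 hz.2 l
    rw [abs_le] at *
    constructor <;> linarith [h1.1, h1.2, h2.1, h2.2]
  have hDt : volume D ≠ ⊤ := by
    have hsub : D ⊆ closedBall (fun i => o (j.succAbove i)) r := by
      intro w hw
      rw [mem_closedBall, dist_eq_norm, pi_norm_le_iff_of_nonneg hr.le]
      intro i
      have := (supN_le_iff o (P w) hr.le).1 hw.2 (j.succAbove i)
      rw [hPs] at this
      exact this
    exact ((measure_mono hsub).trans_lt measure_closedBall_lt_top).ne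
  have hPp : ∀ x : Euc (m+1), x j = a → P (j.removeNth (WithLp.ofLp x)) = x := by
    intro x hx
    ext i
    rcases Fin.eq_self_or_eq_succAbove j i with rfl | ⟨i, rfl⟩
    · rw [hPj, hx]
    · rw [hPs]; rfl
  have hmor := aux_morrey D hDc hDm hD0 hDt (fun w => M (P w)) (hM.comp hPm)
    (ENNReal.ofReal (2 * r) * ((m+1 : ℕ) : ℝ≥0∞)) (fun w => g (P w)) (by
      intro x hx z hz
      have e : ∀ s : ℝ, P (x + s • (z - x)) = P x + s • (P z - P x) := by
        intro s
        have : x + s • (z - x) = (1 - s) • x + s • z := by module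
        rw [this, hPaff x z _ _ (by ring)]
        module
      simp_rw [e]
      apply aux_ftc g hg (P x) (P z) (2 * r) (by positivity) (hdiff _ hx _ hz)
      intro s hs l
      apply hgM
      have : P x + s • (P z - P x) ∈ Cs := hCs.add_smul_sub_mem hx hz ⟨hs.1.le, hs.2.le⟩
      simpa using this.1)
    (j.removeNth (WithLp.ofLp p)) (j.removeNth (WithLp.ofLp q))
    (by show P _ ∈ Cs; rw [hPp p hpj]; exact ⟨by simpa using hp, hpN⟩)
    (by show P _ ∈ Cs; rw [hPp q hqj]; exact ⟨by simpa using hq, hqN⟩)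
  simp only [hPp p hpj, hPp q hqj] at hmor
  have eI : ∫⁻ w : Fin m → ℝ, ({x : Fin (m+1) → ℝ | ‖WithLp.toLp 2 x‖ < 1 - η ∧
        supN o (WithLp.toLp 2 x) ≤ r}.indicator (fun x => M (WithLp.toLp 2 x) ^ (m+1)))
          (j.insertNth a w) = ∫⁻ w in D, M (P w) ^ (m+1) := by
    rw [← lintegral_indicator hDm]
    congr 1; funext w
    by_cases hw : w ∈ D
    · have : ‖P w‖ < 1 - η ∧ supN o (P w) ≤ r := ⟨by simpa using hw.1, hw.2⟩
      rw [indicator_of_mem hw, indicator_of_mem (by exact this)]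
    · have : ¬ (‖P w‖ < 1 - η ∧ supN o (P w) ≤ r) := by
        intro h; exact hw ⟨by simpa using h.1, h.2⟩
      rw [indicator_of_notMem hw, indicator_of_notMem (by exact this)]
  rw [eI]
  set X := ENNReal.ofReal |g p - g q| ^ (m+1)
  set I := ∫⁻ w in D, M (P w) ^ (m+1)
  have hv : ENNReal.ofReal ((r/2)^m) ≠ 0 := by
    rw [ne_eq, ENNReal.ofReal_eq_zero, not_le]; positivity
  have h5 : X * ENNReal.ofReal ((r/2)^m) ≤ ENNReal.ofReal ((4 * ((m:ℝ)+1)^2)^(m+1) * 2 ^ m * r) *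
      I * ENNReal.ofReal ((r/2)^m) := by
    calc _ ≤ X * volume D := by gcongr
      _ ≤ _ := hmor
      _ = _ := by
        have e1 : (2 * (ENNReal.ofReal (2 * r) * ((m+1 : ℕ) : ℝ≥0∞)) * ((m:ℝ≥0∞)+1)) =
            ENNReal.ofReal (4 * ((m:ℝ)+1)^2 * r) := by
          have t2 : (2:ℝ≥0∞) = ENNReal.ofReal 2 := by simp
          have t3 : ((m+1 : ℕ) : ℝ≥0∞) = ENNReal.ofReal ((m:ℝ)+1) := by
            rw [← ENNReal.ofReal_natCast]; push_cast; rfl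
          have t4 : ((m:ℝ≥0∞)+1) = ENNReal.ofReal ((m:ℝ)+1) := by
            rw [← t3]; push_cast; rfl
          rw [t3, t4, t2, ← ENNReal.ofReal_mul (by positivity), ← ENNReal.ofReal_mul (by positivity),
            ← ENNReal.ofReal_mul (by positivity)]
          congr 1; ring
        rw [e1, ← ENNReal.ofReal_pow (by positivity),
          mul_right_comm (ENNReal.ofReal ((4 * ((m:ℝ)+1)^2)^(m+1) * 2 ^ m * r)) I,
          ← ENNReal.ofReal_mul (by positivity)]
        congr 2
        rw [div_pow, mul_pow _ r]
        field_simp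
        ring
  exact (ENNReal.mul_le_mul_iff_left hv ENNReal.ofReal_ne_top).1 h5

lemma aux_good_r (J : ℕ → ℝ → ℝ≥0∞) (hJ : ∀ k, Measurable (J k)) (A : ℝ) (hA : 0 ≤ A)
    (hJA : ∀ᶠ k in atTop, ∫⁻ r, J k r ≤ ENNReal.ofReal A) (τ : ℝ) (hτ : 0 < τ) (hτ1 : τ < 1) :
    ∃ r ∈ Ioo τ (√τ), ∃ᶠ k in atTop,
      J k r ≤ ENNReal.ofReal (2 * (A + τ) / Real.log (1 / τ) * r⁻¹) := by
  by_contra hcon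
  push Not at hcon
  set B := 2 * (A + τ) / Real.log (1 / τ) with hB
  have hlog : 0 < Real.log (1 / τ) := Real.log_pos (by rw [lt_div_iff₀ hτ]; linarith)
  have hB0 : 0 ≤ B := by positivity
  have hsq : 0 < √τ := Real.sqrt_pos.2 hτ
  have hle : τ ≤ √τ := Real.le_sqrt_of_sq_le (by nlinarith)
  have hii : IntervalIntegrable (fun r : ℝ => B * r⁻¹) volume τ (√τ) := by
    apply ContinuousOn.intervalIntegrable
    rw [uIcc_of_le hle]
    apply continuousOn_const.mul
    apply continuousOn_inv₀.mono
    intro x hx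
    exact (hτ.trans_le hx.1).ne'
  have hint : ∫⁻ r in Ioo τ (√τ), ENNReal.ofReal (B * r⁻¹) = ENNReal.ofReal (A + τ) := by
    rw [← ofReal_integral_eq_lintegral_ofReal]
    · rw [← integral_Ioc_eq_integral_Ioo, ← intervalIntegral.integral_of_le hle,
        intervalIntegral.integral_const_mul, integral_inv_of_pos hτ hsq,
        Real.log_div hsq.ne' hτ.ne', Real.log_sqrt hτ.le, hB, one_div, Real.log_inv]
      rw [one_div, Real.log_inv] at hlog
      congr 1
      have : Real.log τ ≠ 0 := by intro h; simp [h] at hlog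
      field_simp
      ring
    · rw [intervalIntegrable_iff_integrableOn_Ioo_of_le hle] at hii
      exact hii
    · filter_upwards [self_mem_ae_restrict measurableSet_Ioo] with r hr
      have : 0 < r := hτ.trans hr.1
      show 0 ≤ B * r⁻¹
      positivity
  have h1 : ENNReal.ofReal (A + τ) ≤ ENNReal.ofReal A := by
    rw [← hint]
    calc _ ≤ ∫⁻ r in Ioo τ (√τ), liminf (fun k => J k r) atTop := by
          apply setLIntegral_mono' measurableSet_Ioo
          intro r hr
          apply le_liminf_of_le
          · isBoundedDefault
          · filter_upwards [hcon r hr] with k hk using hk.le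
      _ ≤ liminf (fun k => ∫⁻ r in Ioo τ (√τ), J k r) atTop := lintegral_liminf_le hJ
      _ ≤ _ := by
          apply liminf_le_of_frequently_le'
          apply Eventually.frequently
          filter_upwards [hJA] with k hk
          exact (setLIntegral_le_lintegral _ _).trans hk
  rw [ENNReal.ofReal_le_ofReal_iff hA] at h1
  linarith

lemma supN_sub_le {n : ℕ} (o x z : Euc n) : supN o (x - z) ≤ supN o x + ‖z‖ := by
  have h1 := supN_le_norm 0 z
  rw [sub_zero] at h1
  have h2 : supN o (x - z) ≤ supN o x + supN 0 z := by
    unfold supN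
    have : x - z - o = (x - o) - (z - 0) := by abel
    rw [this, WithLp.ofLp_sub]
    exact norm_sub_le _ _
  linarith

lemma supN_attained {m : ℕ} (o x : Euc (m+1)) : ∃ j, |x j - o j| = supN o x := by
  obtain ⟨j, hj⟩ := Finite.exists_max (fun j => |x j - o j|)
  refine ⟨j, le_antisymm ?_ ?_⟩
  · exact (supN_le_iff o x (norm_nonneg _)).1 le_rfl j
  · rw [supN_le_iff o x (abs_nonneg _)]
    exact hj

lemma norm_le_of_coord {n : ℕ} (x : Euc n) (β : ℝ) (hb : ∀ i, |x i| ≤ β) : ‖x‖ ≤ n * β := by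
  have e : x = ∑ l, (x l) • (EuclideanSpace.single l (1:ℝ) : Euc n) := by
    ext i
    simp [Finset.sum_apply, Pi.single_apply]
  rw [e]
  refine (norm_sum_le _ _).trans ?_
  calc _ ≤ ∑ _l : Fin n, β := by
        apply Finset.sum_le_sum
        intro l _
        rw [norm_smul]
        simpa using hb l
    _ = _ := by simp

lemma aux_CL {m : ℕ} (h : Euc (m+1) → Euc (m+1)) (Dh : Euc (m+1) → Matrix (Fin (m+1)) (Fin (m+1)) ℝ)
    (hc : ContinuousOn h (unitBall (m+1))) (hb : ∀ x ∈ unitBall (m+1), ‖h x‖ ≤ 1)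
    (hSob : MemSobolev ((m+1 : ℕ) : ℝ) (unitBall (m+1)) h Dh)
    (o : Euc (m+1)) (ho : o = EuclideanSpace.single 0 1) :
    ∃ (K : ℝ) (W : Euc (m+1) → ℝ≥0∞), 0 < K ∧ ∫⁻ x, W x ^ (m+1) ≠ ⊤ ∧
      ∀ τ : ℝ, 0 < τ → τ < 1 → √τ ≤ 1 / (2 * ((m:ℝ)+1)) → ∃ r ∈ Ioo τ (√τ),
        ∀ p ∈ unitBall (m+1), ∀ q ∈ unitBall (m+1), supN o p = r → supN o q = r →
          ‖h p - h q‖ ^ (m+1) ≤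
            K * ((∫⁻ x in {x | supN o x ≤ 2 * √τ}, W x ^ (m+1)).toReal + τ) / Real.log (1 / τ) := by
  obtain ⟨W, M, g, η, hWm, hW, hη, hη0, hMm, hg, hgM, hgl, hMW⟩ :=
    aux_moll (Nat.succ_ne_zero m) h Dh hc hb hSob
  set K0 : ℝ := (4 * ((m:ℝ)+1)^2)^(m+1) * 2 ^ m with hK0
  have hK0p : 0 < K0 := by positivity
  refine ⟨(4 * ((m:ℝ)+1)) ^ (m+1) * K0 * (4 * ((m:ℝ)+1)), W, by positivity, hW, ?_⟩
  intro τ hτ hτ1 hτn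
  set R := √τ with hR
  have hRp : 0 < R := Real.sqrt_pos.2 hτ
  set E := ∫⁻ x in {x | supN o x ≤ 2 * R}, W x ^ (m+1) with hE
  have hEt : E ≠ ⊤ := ((setLIntegral_le_lintegral _ _).trans_lt hW.lt_top).ne
  let S : ℕ → Set (Euc (m+1)) := fun k => {x | ‖x‖ < 1 - η k ∧ supN o x ≤ R}
  have hSm : ∀ k, MeasurableSet (S k) := fun k =>
    (measurableSet_lt measurable_norm measurable_const).inter
      ((supN_cont o).measurable measurableSet_Iic)
  let F : ℕ → (Fin (m+1) → ℝ) → ℝ≥0∞ := fun k x =>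
    (S k).indicator (fun x => M k x ^ (m+1)) (WithLp.toLp 2 x)
  have hFm : ∀ k, Measurable (F k) := fun k =>
    (((hMm k).pow_const _).indicator (hSm k)).comp (PiLp.continuous_toLp 2 _).measurable
  have hFi : ∀ k, ∫⁻ x, F k x = ∫⁻ x in S k, M k x ^ (m+1) := by
    intro k
    rw [← lintegral_indicator (hSm k)]
    exact (PiLp.volume_preserving_toLp (Fin (m+1))).lintegral_comp
      (((hMm k).pow_const _).indicator (hSm k))
  have hFE : ∀ᶠ k in atTop, ∫⁻ x, F k x ≤ E := by
    filter_upwards [hη0.eventually_lt_const hRp] with k hk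
    rw [hFi]
    apply hMW k _ _ (hSm k) ((supN_cont o).measurable measurableSet_Iic)
    intro x hx z hz
    have := supN_sub_le o x z
    have := hx.2
    show supN o (x - z) ≤ 2 * R
    linarith
  let T : ℕ → Fin (m+1) → ℝ → ℝ → ℝ≥0∞ := fun k j σ r =>
    ∫⁻ w : Fin m → ℝ, F k (j.insertNth (o j + σ * r) w)
  have hTm : ∀ k j σ, Measurable (T k j σ) := by
    intro k j σ
    have h1 : Measurable fun q : ℝ × (Fin m → ℝ) => F k (j.insertNth (o j + σ * q.1) q.2) := by
      have h2 : Measurable fun q : ℝ × (Fin m → ℝ) => ((o j + σ * q.1, q.2) : ℝ × (Fin m → ℝ)) := by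
        fun_prop
      exact (hFm k).comp ((aux_insert_meas j).comp h2)
    exact h1.lintegral_prod_right'
  let J : ℕ → ℝ → ℝ≥0∞ := fun k r => ∑ j, (T k j 1 r + T k j (-1) r)
  have hJm : ∀ k, Measurable (J k) := fun k =>
    Finset.measurable_fun_sum _ fun j _ => (hTm k j 1).add (hTm k j (-1))
  have hJi : ∀ k, ∫⁻ r, J k r = ((2 * (m+1) : ℕ) : ℝ≥0∞) * ∫⁻ x, F k x := by
    intro k
    have e : ∫⁻ r, J k r = ∑ j, ∫⁻ r, (T k j 1 r + T k j (-1) r) :=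
      lintegral_finsetSum _ fun j _ => (hTm k j 1).add (hTm k j (-1))
    rw [e]
    have : ∀ j, ∫⁻ r, (T k j 1 r + T k j (-1) r) = 2 * ∫⁻ x, F k x := by
      intro j
      rw [lintegral_add_left (hTm k j 1), aux_fubini j (o j) 1 (Or.inl rfl) _ (hFm k),
        aux_fubini j (o j) (-1) (Or.inr rfl) _ (hFm k), two_mul]
    simp_rw [this]
    simp
    ring
  set A : ℝ := 2 * ((m:ℝ)+1) * E.toReal with hA
  have hJA : ∀ᶠ k in atTop, ∫⁻ r, J k r ≤ ENNReal.ofReal A := by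
    filter_upwards [hFE] with k hk
    have : ENNReal.ofReal A = ((2 * (m+1) : ℕ) : ℝ≥0∞) * E := by
      rw [hA, ENNReal.ofReal_mul (by positivity), ENNReal.ofReal_toReal hEt,
        ← ENNReal.ofReal_natCast]
      push_cast; rfl
    rw [hJi, this]
    gcongr
  have hA0 : 0 ≤ A := by positivity
  obtain ⟨r, hr, hfr⟩ := aux_good_r J hJm A hA0 hJA τ hτ hτ1
  refine ⟨r, hr, ?_⟩
  set B := 2 * (A + τ) / Real.log (1 / τ) with hB
  have hlog : 0 < Real.log (1 / τ) := Real.log_pos (by rw [lt_div_iff₀ hτ]; linarith)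
  have hB0 : 0 ≤ B := by positivity
  have hrp : 0 < r := hτ.trans hr.1
  have hrn : r ≤ 1 / (2 * ((m:ℝ)+1)) := hr.2.le.trans hτn
  set β : ℝ := (K0 * B) ^ ((1:ℝ) / ((m+1 : ℕ) : ℝ)) with hβ
  have hβ0 : 0 ≤ β := by positivity
  have hβn : β ^ (m+1) = K0 * B := by
    rw [hβ, one_div]
    exact Real.rpow_inv_natCast_pow (by positivity) (Nat.succ_ne_zero m)
  have hstep : ∀ (j : Fin (m+1)) (σ : ℝ), (σ = 1 ∨ σ = -1) → (j = 0 → σ = -1) →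
      ∀ p ∈ unitBall (m+1), ∀ q ∈ unitBall (m+1), supN o p ≤ r → supN o q ≤ r →
      p j = o j + σ * r → q j = o j + σ * r → ‖h p - h q‖ ≤ ((m:ℝ)+1) * β := by
    intro j σ hσ hjσ p hp q hq hpN hqN hpj hqj
    have hp1 : ‖p‖ < 1 := by simpa [unitBall] using hp
    have hq1 : ‖q‖ < 1 := by simpa [unitBall] using hq
    have := norm_le_of_coord (h p - h q) β ?_
    · simpa using this
    intro i
    have hlim : Tendsto (fun k => |g k i p - g k i q| ^ (m+1)) atTop
        (𝓝 (|h p i - h q i| ^ (m+1))) :=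
      (((hgl i p hp).sub (hgl i q hq)).abs).pow _
    have hev : ∃ᶠ k in atTop, |g k i p - g k i q| ^ (m+1) ≤ K0 * B := by
      apply (hfr.and_eventually
        ((hη0.eventually_lt_const (show 0 < r / 4 by positivity)).and
        ((hη0.eventually_lt_const (show 0 < 1 - ‖p‖ by linarith)).and
          (hη0.eventually_lt_const (show 0 < 1 - ‖q‖ by linarith))))).mono
      rintro k ⟨hk, hk1, hk2, hk3⟩
      have hf := aux_face (g k i) (hg k i) (M k) (hMm k) (η k) r hrp hrn hk1 (hgM k i) j σ hσ hjσ
        o ho p q (by linarith) (by linarith) hpN hqN hpj hqj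
      have hle : ∫⁻ w : Fin m → ℝ, ({x : Fin (m+1) → ℝ | ‖WithLp.toLp 2 x‖ < 1 - η k ∧
        supN o (WithLp.toLp 2 x) ≤ r}.indicator (fun x => M k (WithLp.toLp 2 x) ^ (m+1)))
          (j.insertNth (o j + σ * r) w) ≤ J k r := by
        calc _ ≤ T k j σ r := by
              apply lintegral_mono
              intro w
              apply indicator_le
              rintro x ⟨hx1, hx2⟩
              show _ ≤ (S k).indicator (fun x => M k x ^ (m+1)) (WithLp.toLp 2 x)
              rw [indicator_of_mem]
              exact ⟨hx1, hx2.trans hr.2.le⟩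
          _ ≤ T k j 1 r + T k j (-1) r := by
              rcases hσ with rfl | rfl
              · exact le_self_add
              · exact le_add_self
          _ ≤ _ := Finset.single_le_sum (f := fun j => T k j 1 r + T k j (-1) r)
              (fun _ _ => zero_le) (Finset.mem_univ j)
      have h3 : ENNReal.ofReal (|g k i p - g k i q| ^ (m+1)) ≤ ENNReal.ofReal (K0 * B) := by
        rw [ENNReal.ofReal_pow (abs_nonneg _)]
        refine hf.trans ?_
        calc _ ≤ ENNReal.ofReal (K0 * r) * ENNReal.ofReal (B * r⁻¹) := by
              gcongr
              exact hle.trans hk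
          _ = _ := by
              rw [← ENNReal.ofReal_mul (by positivity)]
              congr 1
              field_simp
      exact (ENNReal.ofReal_le_ofReal_iff (by positivity)).1 h3
    have h4 := le_of_tendsto_of_frequently hlim hev
    rw [← hβn] at h4
    exact le_of_pow_le_pow_left₀ (Nat.succ_ne_zero m) hβ0 h4
  have hoi : ∀ i, i ≠ 0 → o i = 0 := fun i hi => by rw [ho]; simp [hi]
  have ho0 : o 0 = 1 := by rw [ho]; simp
  have hbox : ∀ x : Euc (m+1), x 0 = 1 - r → (∀ i, i ≠ 0 → |x i| ≤ r) →
      x ∈ unitBall (m+1) ∧ supN o x ≤ r := by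
    intro x hx0 hxi
    have := aux_box r hrp hrn x (by linarith) (by linarith) hxi
    rw [← ho] at this
    refine ⟨?_, this.2⟩
    simp only [unitBall, mem_ball_zero_iff]
    linarith [this.1]
  let a : Euc (m+1) := WithLp.toLp 2 (fun i => if i = 0 then 1 - r else 0)
  have ha0 : a 0 = 1 - r := by simp [a]
  have ha := hbox a ha0 (fun i hi => by simp [a, hi, hrp.le])
  have htoa : ∀ p ∈ unitBall (m+1), supN o p = r → ‖h p - h a‖ ≤ 2 * (((m:ℝ)+1) * β) := by
    intro p hp hpr
    have hmb : 0 ≤ ((m:ℝ)+1) * β := by positivity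
    obtain ⟨j, hj⟩ := supN_attained o p
    rw [hpr] at hj
    by_cases hj0 : j = 0
    · subst hj0
      have hp1 : ‖p‖ < 1 := by simpa [unitBall] using hp
      have hp0 : p 0 < 1 := (le_abs_self _).trans_lt ((PiLp.norm_apply_le p 0).trans_lt hp1)
      rw [ho0, abs_of_neg (by linarith)] at hj
      have := hstep 0 (-1) (Or.inr rfl) (fun _ => rfl) p hp a ha.1 hpr.le ha.2
        (by rw [ho0]; linarith) (by rw [ho0, ha0]; ring)
      linarith
    · have hσ : ∃ σ : ℝ, (σ = 1 ∨ σ = -1) ∧ p j = σ * r := by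
        rw [hoi j hj0, sub_zero] at hj
        rcases abs_eq hrp.le |>.1 hj with h1 | h1
        · exact ⟨1, Or.inl rfl, by linarith⟩
        · exact ⟨-1, Or.inr rfl, by linarith⟩
      obtain ⟨σ, hσ, hpj⟩ := hσ
      let c : Euc (m+1) := WithLp.toLp 2 (fun i => if i = 0 then 1 - r else if i = j then σ * r else 0)
      have hc0 : c 0 = 1 - r := by simp [c]
      have hcj : c j = σ * r := by simp [c, hj0]
      have hcc := hbox c hc0 (fun i hi => by
        by_cases hij : i = j
        · subst hij
          rw [hcj, abs_mul, abs_of_pos hrp]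
          rcases hσ with h | h <;> simp [h]
        · simp [c, hi, hij, hrp.le])
      have s1 := hstep j σ hσ (fun h => absurd h hj0) p hp c hcc.1 hpr.le hcc.2
        (by rw [hoi j hj0, hpj]; ring) (by rw [hoi j hj0, hcj]; ring)
      have s2 := hstep 0 (-1) (Or.inr rfl) (fun _ => rfl) c hcc.1 a ha.1 hcc.2 ha.2
        (by rw [ho0, hc0]; ring) (by rw [ho0, ha0]; ring)
      have := norm_sub_le_norm_sub_add_norm_sub (h p) (h c) (h a)
      linarith
  intro p hp q hq hpr hqr
  have h1 := htoa p hp hpr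
  have h2 := htoa q hq hqr
  have h3 : ‖h p - h q‖ ≤ 4 * ((m:ℝ)+1) * β := by
    have := norm_sub_le_norm_sub_add_norm_sub (h p) (h a) (h q)
    rw [norm_sub_rev (h a)] at this
    linarith
  calc ‖h p - h q‖ ^ (m+1) ≤ (4 * ((m:ℝ)+1) * β) ^ (m+1) := by gcongr
    _ = (4 * ((m:ℝ)+1)) ^ (m+1) * (K0 * B) := by rw [mul_pow, hβn]
    _ ≤ (4 * ((m:ℝ)+1)) ^ (m+1) * (K0 * ((4 * ((m:ℝ)+1)) * (E.toReal + τ) / Real.log (1/τ))) := by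
        gcongr
        rw [hB, hA]
        gcongr ?_ / _
        nlinarith [(Nat.cast_nonneg m : (0:ℝ) ≤ m), mul_nonneg (Nat.cast_nonneg m : (0:ℝ) ≤ m) hτ.le]
    _ = _ := by ring

lemma aux_vol {n : ℕ} (o : Euc n) (hn : n ≠ 0) :
    Tendsto (fun s : ℝ => volume {x | supN o x ≤ 2 * √s}) (𝓝[>] 0) (𝓝 0) := by
  have e : ∀ s : ℝ, volume {x | supN o x ≤ 2 * √s} = ENNReal.ofReal ((2 * (2 * √s)) ^ n) := by
    intro s
    have h1 : {x | supN o x ≤ 2 * √s} = WithLp.ofLp ⁻¹' closedBall (WithLp.ofLp o) (2 * √s) := by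
      refine Set.ext fun x => ?_
      rw [mem_preimage, mem_closedBall, dist_eq_norm]
      rfl
    rw [h1, (PiLp.volume_preserving_ofLp (Fin n)).measure_preimage
      measurableSet_closedBall.nullMeasurableSet, Real.volume_pi_closedBall _ (by positivity),
      Fintype.card_fin]
  simp_rw [e]
  have h2 : Continuous fun s : ℝ => ENNReal.ofReal ((2 * (2 * √s)) ^ n) := by
    apply ENNReal.continuous_ofReal.comp
    fun_prop
  have h3 := h2.tendsto 0
  simp only [Real.sqrt_zero, mul_zero, zero_pow hn, ENNReal.ofReal_zero] at h3
  exact h3.mono_left nhdsWithin_le_nhds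

lemma aux_eps {α : Type*} (X : Set α) (s y : α → ℝ)
    (h1 : ∀ e > 0, ∃ t > 0, ∀ x ∈ X, 0 < s x → s x < t → y x ≤ e)
    (h2 : ∀ t > 0, ∃ C, ∀ x ∈ X, t ≤ s x → s x < 1 → y x ≤ C) :
    ∃ ε : ℝ → ℝ, Monotone ε ∧ (∀ τ, 0 ≤ ε τ) ∧ Tendsto ε (𝓝[>] 0) (𝓝 0) ∧
      ∀ x ∈ X, 0 < s x → s x < 1 → y x ≤ ε (s x) := by
  let G : ℝ → Set ℝ := fun τ => insert 0 {v | ∃ x ∈ X, 0 < s x ∧ s x ≤ τ ∧ s x < 1 ∧ y x = v}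
  have hbdd : ∀ τ, BddAbove (G τ) := by
    intro τ
    obtain ⟨t, ht, h1'⟩ := h1 1 one_pos
    obtain ⟨C, hC⟩ := h2 t ht
    refine ⟨max 1 C, ?_⟩
    rintro v (rfl | ⟨x, hx, hx0, hxτ, hx1, rfl⟩)
    · exact zero_le_one.trans (le_max_left _ _)
    · rcases lt_or_ge (s x) t with h | h
      · exact (h1' x hx hx0 h).trans (le_max_left _ _)
      · exact (hC x hx h hx1).trans (le_max_right _ _)
  have hnn : ∀ τ, 0 ≤ sSup (G τ) := fun τ => le_csSup (hbdd τ) (mem_insert _ _)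
  refine ⟨fun τ => sSup (G τ), ?_, hnn, ?_, ?_⟩
  · intro τ τ' hττ
    apply csSup_le_csSup (hbdd τ') ⟨0, mem_insert _ _⟩
    apply insert_subset_insert
    rintro v ⟨x, hx, hx0, hxτ, hx1, rfl⟩
    exact ⟨x, hx, hx0, hxτ.trans hττ, hx1, rfl⟩
  · rw [Metric.tendsto_nhdsWithin_nhds]
    intro e he
    obtain ⟨t, ht, h1'⟩ := h1 (e/2) (by positivity)
    refine ⟨t, ht, ?_⟩
    intro τ hτ hd
    rw [Real.dist_eq, sub_zero, abs_of_pos hτ] at hd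
    rw [Real.dist_eq, sub_zero, abs_of_nonneg (hnn τ)]
    have : sSup (G τ) ≤ e / 2 := by
      apply csSup_le ⟨0, mem_insert _ _⟩
      rintro v (rfl | ⟨x, hx, hx0, hxτ, hx1, rfl⟩)
      · positivity
      · exact h1' x hx hx0 (hxτ.trans_lt hd)
    linarith
  · intro x hx hx0 hx1
    exact le_csSup (hbdd _) (mem_insert_of_mem _ ⟨x, hx, hx0, le_rfl, hx1, rfl⟩)

lemma aux_main {m : ℕ} (hn : 3 ≤ m + 1) (u : ℝ → ℝ) (hu : IsModelCusp u)
    (h f : Euc (m+1) → Euc (m+1)) (hhf : IsHomeoOn h f (unitBall (m+1)) (cuspBall (m+1) u))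
    (Dh : Euc (m+1) → Matrix (Fin (m+1)) (Fin (m+1)) ℝ)
    (hSob : MemSobolev ((m+1 : ℕ) : ℝ) (unitBall (m+1)) h Dh)
    (H : Euc (m+1) → Euc (m+1)) (hHc : ContinuousOn H (closure (unitBall (m+1))))
    (hHeq : Set.EqOn H h (unitBall (m+1)))
    (o : Euc (m+1)) (ho : o = EuclideanSpace.single 0 1) (hHo : H o = 0) :
    ∃ (s0 : ℝ) (φ : ℝ → ℝ), 0 < s0 ∧ Tendsto φ (𝓝[>] 0) (𝓝 0) ∧
      ∀ x ∈ closure (unitBall (m+1)), 0 < ‖x - o‖ → ‖x - o‖ < s0 →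
        ‖H x‖ ^ (m+1) * Real.log (1 / ‖x - o‖) ≤ φ ‖x - o‖ := by
  have hb : ∀ x ∈ unitBall (m+1), ‖h x‖ ≤ 1 := by
    intro x hx
    have := (hhf.mapsTo hx).1
    rw [mem_ball_zero_iff] at this
    exact this.le
  obtain ⟨K, W, hK, hW, hCL⟩ := aux_CL h Dh hhf.continuousOn hb hSob o ho
  have hocl : o ∈ closure (unitBall (m+1)) := by
    unfold unitBall
    rw [closure_ball _ one_ne_zero, mem_closedBall_zero_iff, ho]
    simp
  have hcont := hHc o hocl
  rw [Metric.continuousWithinAt_iff] at hcont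
  obtain ⟨d, hd, hdH⟩ := hcont (1/2) (by norm_num)
  have hm1 : (0:ℝ) < (m:ℝ) + 1 := by positivity
  set ρ : ℝ := min (1 / (2 * ((m:ℝ)+1))) (d / ((m:ℝ)+1)) with hρ
  have hρ0 : 0 < ρ := by rw [hρ]; positivity
  have hρ1 : ρ ≤ 1 / (2 * ((m:ℝ)+1)) := min_le_left _ _
  have hρ2 : ρ ≤ d / ((m:ℝ)+1) := min_le_right _ _
  have hρh : ρ < 1 := by
    have : 1 / (2 * ((m:ℝ)+1)) < 1 := by
      rw [div_lt_one (by positivity)]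
      linarith [(Nat.cast_nonneg m : (0:ℝ) ≤ m)]
    linarith
  let E : ℝ → ℝ≥0∞ := fun s => ∫⁻ x in {x | supN o x ≤ 2 * √s}, W x ^ (m+1)
  have hE : Tendsto E (𝓝[>] 0) (𝓝 0) :=
    tendsto_setLIntegral_zero hW (aux_vol o (Nat.succ_ne_zero m))
  have hEr : Tendsto (fun s => (E s).toReal) (𝓝[>] 0) (𝓝 0) := by
    have := (ENNReal.tendsto_toReal ENNReal.zero_ne_top).comp hE
    rw [ENNReal.toReal_zero] at this
    exact this
  refine ⟨ρ ^ 2, fun s => 2 ^ (m+1) * (K * ((E s).toReal + s)), by positivity, ?_, ?_⟩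
  · have h0 : Tendsto (fun s : ℝ => s) (𝓝[>] 0) (𝓝 0) := nhdsWithin_le_nhds
    have := ((hEr.add h0).const_mul K).const_mul (2 ^ (m+1))
    simpa using this
  intro x hx hs hs0
  set s := ‖x - o‖ with hsdef
  have hsq : √s < ρ := (Real.sqrt_lt' hρ0).2 hs0
  have hs1 : s < 1 := by nlinarith
  have hlog : 0 < Real.log (1 / s) := Real.log_pos (by rw [lt_div_iff₀ hs]; linarith)
  obtain ⟨r, hr, hrCL⟩ := hCL s hs hs1 (hsq.le.trans hρ1)
  have hrp : 0 < r := hs.trans hr.1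
  set Q := K * ((E s).toReal + s) / Real.log (1 / s) with hQ
  have hQ0 : 0 < Q := by positivity
  set δ := Q ^ ((1:ℝ) / ((m+1 : ℕ) : ℝ)) with hδ
  have hδ0 : 0 < δ := by positivity
  have hδn : δ ^ (m+1) = Q := by
    rw [hδ, one_div]
    exact Real.rpow_inv_natCast_pow hQ0.le (Nat.succ_ne_zero m)
  have htopo := aux_topo hn hu h f hhf H hHc hHeq o hocl hHo (supN o) (supN_cont o)
    (supN_convex_lt o) (by simp [supN]) r hrp (by
      intro z hz hzr
      have h1 := norm_le_of_coord (z - o) r ((supN_le_iff o z hrp.le).1 hzr)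
      have h2 : ‖z - o‖ < d := by
        rw [le_div_iff₀ hm1] at hρ2
        push_cast at h1
        have : r < ρ := hr.2.trans hsq
        nlinarith
      have h3 := hdH (subset_closure hz) (by rw [dist_eq_norm]; exact h2)
      rw [hHo, dist_zero_right, hHeq hz] at h3
      exact h3.le) δ hδ0 (by
      intro p hp q hq hpr hqr
      have := hrCL p hp q hq hpr hqr
      apply le_of_pow_le_pow_left₀ (Nat.succ_ne_zero m) hδ0.le
      rw [hδn]
      exact this)
  have hHx : ‖H x‖ ≤ 2 * δ := by
    have hne : (𝓝[unitBall (m+1)] x).NeBot := mem_closure_iff_nhdsWithin_neBot.1 hx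
    have ht : Tendsto (fun z => ‖H z‖) (𝓝[unitBall (m+1)] x) (𝓝 ‖H x‖) :=
      ((hHc x hx).mono subset_closure).norm
    apply le_of_tendsto ht
    have hopen : ∀ᶠ z in 𝓝[unitBall (m+1)] x, supN o z < r :=
      nhdsWithin_le_nhds (((supN_cont o).tendsto x).eventually_lt_const
        ((supN_le_norm o x).trans_lt hr.1))
    filter_upwards [hopen, self_mem_nhdsWithin] with z hz hzB
    rw [hHeq hzB]
    exact htopo z hzB hz
  calc ‖H x‖ ^ (m+1) * Real.log (1 / s) ≤ (2 * δ) ^ (m+1) * Real.log (1 / s) := by gcongr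
    _ = _ := by
      rw [mul_pow, hδn, hQ]
      field_simp

/-- Modulus of continuity at the cusp tip: if `h : 𝔹 → 𝔹_u` has finite
conformal energy, `H` extends `h` continuously and `H(o′) = o = 0`, then
`|H(x′) − o| ≤ ε(|x′ − o′|) · log^{-1/n}(1/|x′ − o′|)` with `ε` increasing and `ε(τ) → 0`
as `τ → 0⁺`. -/
theorem stmt_17 {n : ℕ} [NeZero n] (hn : 3 ≤ n) (u : ℝ → ℝ) (hu : IsModelCusp u)
    (h f : Euc n → Euc n) (hhf : IsHomeoOn h f (unitBall n) (cuspBall n u))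
    (Dh : Euc n → Matrix (Fin n) (Fin n) ℝ)
    (hSob : MemSobolev (n : ℝ) (unitBall n) h Dh)
    (H : Euc n → Euc n) (hHc : ContinuousOn H (closure (unitBall n)))
    (hHmaps : Set.MapsTo H (closure (unitBall n)) (closure (cuspBall n u)))
    (hHeq : Set.EqOn H h (unitBall n))
    (hHo : H (EuclideanSpace.single (0 : Fin n) (1 : ℝ)) = 0) :
    ∃ ε : ℝ → ℝ,
      MonotoneOn ε (Set.Ico (0 : ℝ) 1) ∧
      (∀ τ ∈ Set.Ico (0 : ℝ) 1, 0 ≤ ε τ) ∧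
      Filter.Tendsto ε (nhdsWithin 0 (Set.Ioi 0)) (nhds 0) ∧
      ∀ x' ∈ closure (unitBall n),
        0 < ‖x' - EuclideanSpace.single (0 : Fin n) (1 : ℝ)‖ →
        ‖x' - EuclideanSpace.single (0 : Fin n) (1 : ℝ)‖ < 1 →
        ‖H x'‖ ≤ ε ‖x' - EuclideanSpace.single (0 : Fin n) (1 : ℝ)‖ /
          (Real.log (1 / ‖x' - EuclideanSpace.single (0 : Fin n) (1 : ℝ)‖)) ^ ((1 : ℝ) / n) := by
  obtain ⟨m, rfl⟩ : ∃ m, n = m + 1 := ⟨n - 1, by omega⟩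
  set o : Euc (m+1) := EuclideanSpace.single (0 : Fin (m+1)) (1 : ℝ) with ho
  obtain ⟨s0, φ, hs0, hφ, hmain⟩ := aux_main hn u hu h f hhf Dh hSob H hHc hHeq o ho hHo
  have hH1 : ∀ x ∈ closure (unitBall (m+1)), ‖H x‖ ≤ 1 := by
    intro x hx
    have h1 : closure (cuspBall (m+1) u) ⊆ closedBall 0 1 :=
      closure_minimal (fun y hy => ball_subset_closedBall hy.1) isClosed_closedBall
    simpa using h1 (hHmaps hx)
  have hlogp : ∀ t : ℝ, 0 < t → t < 1 → 0 < Real.log (1 / t) := fun t h0 h1 =>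
    Real.log_pos (by rw [lt_div_iff₀ h0]; linarith)
  obtain ⟨ε, hε1, hε2, hε3, hε4⟩ := aux_eps (closure (unitBall (m+1))) (fun x => ‖x - o‖)
    (fun x => ‖H x‖ * (Real.log (1 / ‖x - o‖)) ^ ((1 : ℝ) / ((m+1 : ℕ) : ℝ))) (by
      intro e he
      have h1 := hφ.eventually_lt_const (show 0 < e ^ (m+1) by positivity)
      obtain ⟨t, ht, ht1⟩ := Metric.eventually_nhds_iff_ball.1 (eventually_nhdsWithin_iff.1 h1)
      refine ⟨min (min t s0) 1, by positivity, ?_⟩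
      intro x hx hx0 hxt
      have hxt1 : ‖x - o‖ < t := hxt.trans_le ((min_le_left _ _).trans (min_le_left _ _))
      have hxt2 : ‖x - o‖ < s0 := hxt.trans_le ((min_le_left _ _).trans (min_le_right _ _))
      have hxt3 : ‖x - o‖ < 1 := hxt.trans_le (min_le_right _ _)
      have hm := hmain x hx hx0 hxt2
      have hl := hlogp _ hx0 hxt3
      have hp := ht1 _ (by rw [Real.ball_eq_Ioo]; constructor <;> linarith) hx0
      apply le_of_pow_le_pow_left₀ (Nat.succ_ne_zero m) he.le
      rw [mul_pow, one_div ((m+1 : ℕ) : ℝ),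
        Real.rpow_inv_natCast_pow hl.le (Nat.succ_ne_zero m)]
      exact hm.trans hp.le) (by
      intro t ht
      refine ⟨(Real.log (1 / t)) ^ ((1 : ℝ) / ((m+1 : ℕ) : ℝ)), ?_⟩
      intro x hx hxt hx1
      have hx0 : 0 < ‖x - o‖ := ht.trans_le hxt
      have hl := hlogp _ hx0 hx1
      calc _ ≤ 1 * (Real.log (1 / ‖x - o‖)) ^ ((1 : ℝ) / ((m+1 : ℕ) : ℝ)) := by
            gcongr
            exact hH1 x hx
        _ ≤ _ := by
            rw [one_mul]
            gcongr)
  refine ⟨ε, hε1.monotoneOn _, fun τ _ => hε2 τ, hε3, ?_⟩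
  intro x hx hx0 hx1
  have hl := hlogp _ hx0 hx1
  rw [le_div_iff₀ (by positivity)]
  exact hε4 x hx hx0 hx1
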